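/- arXiv:math/0510100 — 17 statements merged into one kernel-verified Lean document; each statement's English description precedes it below -/
import Mathlib

section
/- Let p be a prime, and let h, k be positive integers with p ∤ h and k ≥ 5. Suppose that 3h < 2k + 5, or that p = 3 and 5h < 4k + 9. Suppose that the signed binomial coefficient (-1)^i * C(k,i) viewed modulo p is a periodic function of i with period h in the range 0 ≤ i ≤ k, i.e. C(k, i+h) ≡ (-1)^h * C(k,i) (mod p) for all integers i with 0 ≤ i ≤ k - h. Then k + 1 is a power of p. -/
/-- If the signed binomial coefficients `(-1)^i * C(k,i)` are periodic with period `h` modulo a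
prime not dividing `h`, then they all equal `1` for `i ≤ k - h`. -/
theorem choose_eq_neg_one_pow_of_periodic {p h k : ℕ} [Fact p.Prime] (hph : ¬ p ∣ h)
    (hper : ∀ i : ℕ, i + h ≤ k → (k.choose (i + h) : ZMod p) = (-1) ^ h * k.choose i)
    (i : ℕ) (hi : i + h ≤ k) : (k.choose i : ZMod p) = (-1) ^ i := by
  induction i with
  | zero => simp
  | succ i ih =>
    have hcur := ih (by omega)
    have hshift := hper i (by omega)
    have hshift_succ := hper (i + 1) hi
    have recur (j : ℕ) (hj : j ≤ k) :
        (k.choose (j + 1) : ZMod p) * (j + 1) = k.choose j * (k - j) := by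
      have := congrArg (Nat.cast : ℕ → ZMod p) (Nat.choose_succ_right_eq k j)
      simpa [Nat.cast_sub hj] using this
    have hrec := recur i (by omega)
    have hrec_shift := recur (i + h) (by omega)
    have hh : (h : ZMod p) ≠ 0 := by rwa [Ne, ZMod.natCast_eq_zero_iff]
    rw [show i + h + 1 = i + 1 + h by ring, hshift, hshift_succ] at hrec_shift
    have hsign : ((-1 : ZMod p) ^ h) * (-1) ^ h = 1 := by
      rw [← mul_pow]; simp
    push_cast at hrec_shift
    have hsum : (h : ZMod p) * (k.choose (i + 1) + k.choose i) = 0 := by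
      linear_combination (-1 : ZMod p) ^ h * hrec_shift - hrec -
        ((k.choose (i + 1) : ZMod p) * (i + h + 1) - k.choose i * (k - i - h)) * hsign
    have := (mul_eq_zero.mp hsum).resolve_left hh
    rw [pow_succ]
    linear_combination this - hcur

/-- If `C(k,j) ≡ (-1)^j` modulo `p` for `j = i` and `j = i + 1`, where `i + 1` is a power of `p`,
then `k + 1` is divisible by `p * (i + 1)`. -/
theorem mul_dvd_succ_of_choose_eq_neg_one_pow {p k i : ℕ} [Fact p.Prime]
    (hi : (k.choose i : ZMod p) = (-1) ^ i)
    (hi' : (k.choose (i + 1) : ZMod p) = (-1) ^ (i + 1))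
    (hpow : ∃ j, i + 1 = p ^ j) : p * (i + 1) ∣ k + 1 := by
  have hp : p.Prime := Fact.out
  have hdvd : p ∣ (k + 1).choose (i + 1) := by
    rw [← ZMod.natCast_eq_zero_iff, Nat.choose_succ_succ, Nat.cast_add, hi, hi']
    ring
  have hmul : p * (i + 1) ∣ (k + 1) * k.choose i := by
    rw [Nat.add_one_mul_choose_eq]
    exact Nat.mul_dvd_mul_right hdvd _
  have hcop : Nat.Coprime p (k.choose i) := by
    rw [hp.coprime_iff_not_dvd, ← ZMod.natCast_eq_zero_iff, hi]
    exact pow_ne_zero _ (by simp)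
  obtain ⟨j, hj⟩ := hpow
  refine Nat.Coprime.dvd_of_dvd_mul_right ?_ hmul
  rw [hj]
  exact hcop.mul_left (hcop.pow_left j)

/-- If `C(k,i) ≡ (-1)^i` modulo `p` for all `i ≤ m`, then `k + 1` is divisible by a power of `p`
exceeding `m`. -/
theorem exists_pow_gt_dvd_succ {p k m : ℕ} [Fact p.Prime]
    (hone : ∀ i ≤ m, (k.choose i : ZMod p) = (-1) ^ i) :
    ∃ s, m < p ^ s ∧ p ^ s ∣ k + 1 := by
  have hp : p.Prime := Fact.out
  have hex : ∃ s, m < p ^ s := ⟨m, Nat.lt_pow_self hp.one_lt⟩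
  classical
  refine ⟨Nat.find hex, Nat.find_spec hex, ?_⟩
  rcases hs : Nat.find hex with _ | j
  · simp
  · have hj : p ^ j ≤ m := not_lt.mp (Nat.find_min hex (by omega))
    have hpos : 0 < p ^ j := pow_pos hp.pos j
    obtain ⟨i, hij⟩ : ∃ i, p ^ j = i + 1 := ⟨p ^ j - 1, by omega⟩
    rw [pow_succ', hij]
    exact mul_dvd_succ_of_choose_eq_neg_one_pow (hone i (by omega)) (hone (i + 1) (by omega))
      ⟨j, hij.symm⟩

/-- If `C(k,i) ≡ (-1)^i` modulo `p` holds for `i = h` and `i = k - h`, then `p = 2` or `k` is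
even. -/
theorem eq_two_or_even_of_choose_eq_neg_one_pow {p h k : ℕ} [Fact p.Prime] (hhk : h ≤ k)
    (hleft : (k.choose h : ZMod p) = (-1) ^ h)
    (hright : (k.choose (k - h) : ZMod p) = (-1) ^ (k - h)) : p = 2 ∨ Even k := by
  rw [Nat.choose_symm hhk, hleft] at hright
  by_contra! hcon
  have hk : (-1 : ZMod p) ^ k = -1 := (Nat.not_even_iff_odd.mp hcon.2).neg_one_pow
  have hsq : (-1 : ZMod p) ^ h * (-1) ^ h = 1 := by rw [← mul_pow]; simp
  rw [← Nat.add_sub_cancel' hhk, pow_add, ← hright, hsq] at hk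
  have : Fact (2 < p) := ⟨lt_of_le_of_ne (Fact.out : p.Prime).two_le hcon.1.symm⟩
  exact ZMod.neg_one_ne_one hk.symm

/-- A power of a prime `p` that has a multiple not divisible by `p` equals `1`. -/
theorem prime_pow_eq_one_of_not_dvd_mul {p s c : ℕ} (h : ¬ p ∣ c * p ^ s) : p ^ s = 1 := by
  rcases s with _ | s
  · simp
  · exact absurd (Dvd.dvd.mul_left (dvd_pow_self p s.succ_ne_zero) c) h

/-- **Theorem (main theorem).** Let `p` be a prime, and let `h, k` be positive integers with
`p ∤ h` and `k ≥ 5`. Suppose that `3h < 2k + 5`, or that `p = 3` and `5h < 4k + 9`.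
Suppose that the signed binomial coefficient `(-1)^i * C(k,i)` viewed modulo `p` is a periodic
function of `i` with period `h` in the range `0 ≤ i ≤ k`, that is,
`C(k, i+h) ≡ (-1)^h * C(k,i) (mod p)` for `0 ≤ i ≤ k - h`.
Then `k + 1` is a power of `p`. -/
theorem modular_periodicity_main (p h k : ℕ) (hp : p.Prime) (hh : 0 < h) (hk : 5 ≤ k)
    (hph : ¬ p ∣ h)
    (hineq : 3 * h < 2 * k + 5 ∨ (p = 3 ∧ 5 * h < 4 * k + 9))
    (hper : ∀ i : ℕ, i + h ≤ k →
      ((k.choose (i + h) : ℤ) ≡ (-1) ^ h * (k.choose i) [ZMOD (p : ℤ)])) :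
    ∃ r : ℕ, k + 1 = p ^ r := by
  have : Fact p.Prime := ⟨hp⟩
  have hhk : h ≤ k ∧ (h = k → k ≤ 8) := by omega
  have hper' : ∀ i : ℕ, i + h ≤ k → (k.choose (i + h) : ZMod p) = (-1) ^ h * k.choose i := by
    intro i hi
    simpa using (ZMod.intCast_eq_intCast_iff _ _ p).mpr (hper i hi)
  have hone := choose_eq_neg_one_pow_of_periodic hph hper'
  obtain ⟨s, hlt, n, hn⟩ := exists_pow_gt_dvd_succ (p := p) (k := k) (m := k - h)
    fun i hi => hone i (by omega)
  have heven : p = 2 ∨ Even k := eq_two_or_even_of_choose_eq_neg_one_pow hhk.1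
    (by simpa using hper' 0 (by omega)) (hone (k - h) (by omega))
  have hmul_one (c : ℕ) (hc : h = c * p ^ s) : p ^ s = 1 :=
    prime_pow_eq_one_of_not_dvd_mul (hc ▸ hph)
  have hpos : 0 < p ^ s := pow_pos hp.pos s
  by_cases hn1 : n = 1
  · exact ⟨s, by rw [hn, hn1, mul_one]⟩
  by_cases hnp : n = p
  · exact ⟨s + 1, by rw [hn, hnp, pow_succ]⟩
  have hn0 : n ≠ 0 := by rintro rfl; omega
  have hodd : p = 2 ∨ n % 2 = 1 := by
    refine heven.imp_right fun hk' => ?_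
    have : Odd (p ^ s * n) := hn ▸ hk'.add_one
    exact Nat.odd_iff.mp (Nat.odd_mul.mp this).2
  generalize hq : p ^ s = q at *
  rcases hineq with hA | ⟨rfl, hB⟩
  · rcases (show n = 2 ∨ n = 3 ∨ n = 4 ∨ 5 ≤ n by omega) with rfl | rfl | rfl | hn5
    · omega
    · have := hmul_one 2 (by omega)
      omega
    · obtain rfl : p = 2 := by omega
      exact ⟨3, by omega⟩
    · have := Nat.mul_le_mul_left q hn5
      omega
  · rcases (show n = 5 ∨ 7 ≤ n by omega) with rfl | hn7
    · have := hmul_one 4 (by omega)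
      omega
    · have := Nat.mul_le_mul_left q hn7
      have hq1 : q = 1 := by
        have : q ≠ 2 := by
          rintro rfl
          have : Odd (3 ^ s) := Odd.pow (by decide)
          rw [hq] at this
          exact absurd this (by decide)
        omega
      have hk8 : k = 8 := by
        obtain ⟨c, hc⟩ := heven.resolve_left (by norm_num)
        omega
      exact ⟨2, by omega⟩
end

section
/- Let k be a positive integer and write k + 1 = p^r * t, where p is a prime and p ∤ t. If t > 1, then the signed binomial coefficient (-1)^i * C(k,i) viewed modulo p is not a periodic function of i in the range 0 ≤ i ≤ k for any period h with h ≤ k - p^r and p ∤ h. In other words, for every positive integer h with p ∤ h and h ≤ k - p^r, there exists an integer i with 0 ≤ i ≤ k - h such that C(k, i+h) ≢ (-1)^h * C(k,i) (mod p). -/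
/-- A special case of Lucas' theorem: a common factor `p ^ r` can be cancelled modulo `p`. -/
theorem choose_prime_pow_mul_modEq {p : ℕ} (hp : p.Prime) (r n m : ℕ) :
    (p ^ r * n).choose (p ^ r * m) ≡ n.choose m [MOD p] := by
  have : Fact p.Prime := ⟨hp⟩
  induction r with
  | zero => simp [Nat.ModEq]
  | succ r ih =>
    have lucas := Choose.choose_modEq_choose_mod_mul_choose_div_nat
      (n := p * (p ^ r * n)) (k := p * (p ^ r * m)) (p := p)
    simp only [Nat.mul_mod_right, Nat.mul_div_cancel_left _ hp.pos, Nat.choose_self,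
      one_mul] at lucas
    rw [pow_succ', mul_assoc, mul_assoc]
    exact lucas.trans ih

/-- **Proposition.** Let `k` be a positive integer and write `k + 1 = p^r * t` with `p` prime
and `p ∤ t`. If `t > 1`, then for every positive integer `h` with `p ∤ h` and `h ≤ k - p^r`,
the signed binomial coefficient `(-1)^i * C(k,i)` modulo `p` is not a periodic function of `i`
with period `h` in the range `0 ≤ i ≤ k`: there exists `i` with `0 ≤ i ≤ k - h` such that
`C(k, i+h) ≢ (-1)^h * C(k,i) (mod p)`. -/
theorem modular_periodicity_prop (p r t k : ℕ) (hp : p.Prime) (hk : 0 < k)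
    (hkdecomp : k + 1 = p ^ r * t) (hpt : ¬ p ∣ t) (ht : 1 < t) :
    ∀ h : ℕ, 0 < h → ¬ p ∣ h → h + p ^ r ≤ k →
      ∃ i : ℕ, i + h ≤ k ∧
        ¬ ((k.choose (i + h) : ℤ) ≡ (-1) ^ h * (k.choose i) [ZMOD (p : ℤ)]) := by
  intro h _ hph hle
  by_contra! periodic
  have : Fact p.Prime := ⟨hp⟩
  obtain ⟨q, hq⟩ : ∃ q, p ^ r = q + 1 :=
    Nat.exists_eq_succ_of_ne_zero (pow_ne_zero r hp.ne_zero)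
  have periodic_zmod (i : ℕ) (hi : i + h ≤ k) :
      (k.choose (i + h) : ZMod p) = (-1) ^ h * k.choose i := by
    have := (ZMod.intCast_eq_intCast_iff _ _ p).2 (periodic i hi)
    push_cast at this
    exact this
  have eq_low := periodic_zmod q (by omega)
  have eq_high := periodic_zmod (q + 1) (by omega)
  have absorb (i : ℕ) : ((k : ZMod p) + 1) * k.choose i =
      ((k.choose i : ZMod p) + k.choose (i + 1)) * (i + 1) := by
    have := Nat.add_one_mul_choose_eq k i
    rw [Nat.choose_succ_succ'] at this
    exact_mod_cast congrArg (Nat.cast : ℕ → ZMod p) this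
  have absorb_low := absorb q
  have absorb_high := absorb (q + h)
  rw [show q + h + 1 = q + 1 + h by ring, eq_low, eq_high] at absorb_high
  have sign_ne : ((-1 : ZMod p)) ^ h ≠ 0 := pow_ne_zero _ (neg_ne_zero.2 one_ne_zero)
  have h_ne : (h : ZMod p) ≠ 0 := by rwa [Ne, ZMod.natCast_eq_zero_iff]
  have t_ne : (t : ZMod p) ≠ 0 := by rwa [Ne, ZMod.natCast_eq_zero_iff]
  have jump : (k.choose q : ZMod p) + k.choose (q + 1) = t := by
    have := (ZMod.natCast_eq_natCast_iff _ _ p).2 (choose_prime_pow_mul_modEq hp r t 1)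
    rw [← hkdecomp, mul_one, hq, Nat.choose_succ_succ', Nat.choose_one_right] at this
    exact_mod_cast this
  refine mul_ne_zero (mul_ne_zero sign_ne h_ne) t_ne ?_
  rw [← jump]
  push_cast at absorb_high
  linear_combination (-1) ^ h * absorb_low - absorb_high
end

section
/- Let p be a prime, and let h, k be positive integers with p ∤ h and 2h ≤ k. Suppose that the signed binomial coefficient (-1)^i * C(k,i) viewed modulo p is a periodic function of i with period h in the range 0 ≤ i ≤ k, i.e. C(k, i+h) ≡ (-1)^h * C(k,i) (mod p) for all integers i with 0 ≤ i ≤ k - h. Then k + 1 is a power of p. -/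
open Polynomial

/-- If `(1 - X) ^ n = 1 - X ^ n` in characteristic `p`, then `n` is a power of `p`. -/
theorem exists_eq_prime_pow_of_one_sub_X_pow {p n : ℕ} [Fact p.Prime] (hn : n ≠ 0)
    (h : (1 - X : (ZMod p)[X]) ^ n = 1 - X ^ n) : ∃ r : ℕ, n = p ^ r := by
  have hp : p.Prime := Fact.out
  obtain ⟨r, m, hm, rfl⟩ := Nat.exists_eq_pow_mul_and_not_dvd hn p hp.ne_one
  have h1 : (1 - X : (ZMod p)[X]) ^ m = 1 - X ^ m := by
    apply iterateFrobenius_inj (ZMod p)[X] p r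
    simp only [iterateFrobenius_def]
    rw [sub_pow_char_pow, one_pow, ← pow_mul, ← pow_mul, mul_comm m, h]
  refine ⟨r, ?_⟩
  have hm1 : m = 1 := by
    by_contra hne
    have hm0 : m ≠ 0 := by rintro rfl; simp at hm
    have h2 := congrArg (fun q => eval 1 (derivative q)) h1
    have hm2 : m - 1 ≠ 0 := by omega
    simp [derivative_pow, hm2] at h2
    exact hm ((ZMod.natCast_eq_zero_iff m p).1 h2)
  rw [hm1, mul_one]

theorem coeff_one_sub_X_pow_eq {R : Type*} [CommRing R] (k i : ℕ) :
    ((1 - X : R[X]) ^ k).coeff i = (-1) ^ i * (k.choose i : R) := by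
  have h : (1 - X : R[X]) ^ k = ((1 + X) ^ k).comp (C (-1) * X) := by
    simp [sub_eq_add_neg]
  rw [h, comp_C_mul_X_coeff, coeff_one_add_X_pow, mul_comm]

/-- Multiplying a polynomial of degree at most `k` with `h`-periodic coefficients by `1 - X ^ h`
leaves only the terms of degree below `h` and above `k`. -/
theorem mul_one_sub_X_pow_of_periodic {R : Type*} [CommRing R] {F : R[X]} {h k : ℕ}
    (hk : h ≤ k) (hdeg : F.natDegree ≤ k)
    (hper : ∀ i, i + h ≤ k → F.coeff (i + h) = F.coeff i) :
    F * (1 - X ^ h) = (∑ i ∈ Finset.range h, C (F.coeff i) * X ^ i) +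
      X ^ (k + 1) * -∑ i ∈ Finset.range h, C (F.coeff (k + 1 - h + i)) * X ^ i := by
  ext n
  rw [mul_sub, mul_one, coeff_sub, coeff_mul_X_pow', coeff_add, coeff_X_pow_mul', coeff_neg,
    finsetSum_coeff, finsetSum_coeff]
  simp only [coeff_C_mul, coeff_X_pow, mul_ite, mul_one, mul_zero, Finset.sum_ite_eq,
    Finset.mem_range]
  have hz : k < n → F.coeff n = 0 := fun hn => coeff_eq_zero_of_natDegree_lt (by omega)
  by_cases h1 : h ≤ n
  · by_cases h2 : k + 1 ≤ n
    · rw [if_pos h1, if_pos h2, hz h2, if_neg (by omega : ¬ n < h)]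
      by_cases h3 : n - (k + 1) < h
      · rw [if_pos h3, show k + 1 - h + (n - (k + 1)) = n - h by omega, zero_sub, zero_add]
      · rw [if_neg h3, coeff_eq_zero_of_natDegree_lt (by omega : F.natDegree < n - h)]
        simp
    · have h3 := hper (n - h) (by omega)
      rw [Nat.sub_add_cancel h1] at h3
      rw [if_pos h1, if_neg h2, if_neg (by omega : ¬ n < h), h3]
      simp
  · rw [if_neg h1, if_pos (by omega : n < h), if_neg (by omega : ¬ k + 1 ≤ n)]
    simp

theorem natDegree_sum_C_mul_X_pow_le {R : Type*} [CommRing R] (f : ℕ → R) (h : ℕ) :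
    (∑ i ∈ Finset.range h, C (f i) * X ^ i).natDegree ≤ h - 1 :=
  natDegree_sum_le_of_forall_le _ _ fun i hi =>
    (natDegree_C_mul_X_pow_le _ _).trans (by have := Finset.mem_range.1 hi; omega)

/-- If `(1 - X) ^ (k + 1) * P = A + X ^ (k + 1) * B` with `A`, `B` of degree less than `h` and
`2 * h ≤ k`, then the Wronskian of `A` and the left-hand side vanishes. -/
theorem mul_derivative_eq_of_one_sub_X_pow {K : Type*} [Field K] {A B P : K[X]} {h k : ℕ}
    (hh : 0 < h) (h2h : 2 * h ≤ k) (hA : A.natDegree ≤ h - 1) (hB : B.natDegree ≤ h - 1)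
    (hP : (1 - X) ^ (k + 1) * P = A + X ^ (k + 1) * B) :
    A * derivative ((1 - X) ^ (k + 1) * P) = derivative A * ((1 - X) ^ (k + 1) * P) := by
  set D : K[X] := ((k + 1 : ℕ) : K[X]) * (A * B) +
    X * (A * derivative B) - X * (derivative A * B) with hD
  have hW : A * derivative ((1 - X) ^ (k + 1) * P) - derivative A * ((1 - X) ^ (k + 1) * P) =
      X ^ k * D := by
    rw [hP, hD]
    simp only [derivative_add, derivative_mul, derivative_X_pow, Nat.add_sub_cancel, map_natCast]
    ring
  have hdvd : (1 - X : K[X]) ^ k ∣ X ^ k * D := by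
    rw [← hW]
    refine ⟨A * (-((k + 1 : ℕ) : K[X]) * P + (1 - X) * derivative P) -
      derivative A * ((1 - X) * P), ?_⟩
    simp only [derivative_mul, derivative_pow, derivative_sub, derivative_one, derivative_X,
      Nat.add_sub_cancel, map_natCast]
    ring
  have hcop : IsCoprime ((1 - X : K[X]) ^ k) (X ^ k) :=
    IsCoprime.pow ⟨1, 1, by ring⟩
  have hD0 : D = 0 := by
    refine eq_zero_of_dvd_of_natDegree_lt (hcop.dvd_of_dvd_mul_left hdvd) ?_
    have hA' := natDegree_derivative_le A
    have hB' := natDegree_derivative_le B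
    have e1 : (((k + 1 : ℕ) : K[X]) * (A * B)).natDegree ≤ 2 * h - 1 := by
      rw [← C_eq_natCast]
      exact (natDegree_C_mul_le _ _).trans (natDegree_mul_le.trans (by omega))
    have e2 : (X * (A * derivative B)).natDegree ≤ 2 * h - 1 := by
      have i1 := natDegree_mul_le (p := (X : K[X])) (q := A * derivative B)
      have i2 := natDegree_mul_le (p := A) (q := derivative B)
      rw [natDegree_X] at i1
      omega
    have e3 : (X * (derivative A * B)).natDegree ≤ 2 * h - 1 := by
      have i1 := natDegree_mul_le (p := (X : K[X])) (q := derivative A * B)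
      have i2 := natDegree_mul_le (p := derivative A) (q := B)
      rw [natDegree_X] at i1
      omega
    have e4 : (1 - X : K[X]).natDegree = 1 := by
      rw [← natDegree_neg, neg_sub, ← C_1, natDegree_X_sub_C]
    rw [natDegree_pow, e4, mul_one]
    exact (natDegree_sub_le_of_le (natDegree_add_le_of_le e1 e2) e3).trans_lt
      (by simp only [max_self]; omega)
  rw [hD0, mul_zero] at hW
  exact sub_eq_zero.1 hW

/-- If `(h : K) ≠ 0` and the Wronskian of `A` and `(1 - X) ^ n * (1 + X + ⋯ + X ^ (h - 1))`
vanishes, then `1 + X + ⋯ + X ^ (h - 1)` divides `A`. -/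
theorem geom_sum_dvd_of_mul_derivative_eq {K : Type*} [Field K] {A : K[X]} {h n : ℕ}
    (hh : (h : K) ≠ 0)
    (hW : A * derivative ((1 - X) ^ n * ∑ i ∈ Finset.range h, X ^ i) =
      derivative A * ((1 - X) ^ n * ∑ i ∈ Finset.range h, X ^ i)) :
    ∑ i ∈ Finset.range h, X ^ i ∣ A := by
  have hsep : ((∑ i ∈ Finset.range h, X ^ i : K[X]) * (X - 1)).Separable := by
    rw [geom_sum_mul]
    exact X_pow_sub_one_separable_iff.2 hh
  have hcop1 := hsep.isCoprime
  have hcop2 : IsCoprime (∑ i ∈ Finset.range h, X ^ i : K[X]) _ := hsep.of_mul_left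
  generalize (∑ i ∈ Finset.range h, X ^ i : K[X]) = G at *
  have hcop3 : IsCoprime G ((1 - X) ^ n) := by
    rw [← neg_sub]
    exact hcop1.neg_right.pow_right
  refine (hcop3.mul_right hcop2).dvd_of_dvd_mul_right
    (⟨derivative A * (1 - X) ^ n - A * derivative ((1 - X) ^ n), ?_⟩)
  rw [derivative_mul] at hW
  linear_combination hW

/-- A polynomial of degree less than `h` with constant coefficient `1` that is divisible by
`1 + X + ⋯ + X ^ (h - 1)` equals it. -/
theorem eq_geom_sum_of_dvd {K : Type*} [Field K] {A : K[X]} {h : ℕ} (hh : 0 < h)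
    (hA : A.natDegree ≤ h - 1) (hA0 : A.coeff 0 = 1) (hdvd : ∑ i ∈ Finset.range h, X ^ i ∣ A) :
    A = ∑ i ∈ Finset.range h, X ^ i := by
  obtain ⟨q, rfl⟩ := hdvd
  have hG : (∑ i ∈ Finset.range h, X ^ i : K[X]).Monic := monic_geom_sum_X hh.ne'
  have hGdeg : h - 1 ≤ (∑ i ∈ Finset.range h, X ^ i : K[X]).natDegree :=
    le_natDegree_of_ne_zero (by
      simp [coeff_X_pow, hh])
  have hq0 : q ≠ 0 := by rintro rfl; simp at hA0
  rw [hG.natDegree_mul' hq0] at hA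
  have hq := eq_C_of_natDegree_eq_zero (by omega : q.natDegree = 0)
  have hG0 : (∑ i ∈ Finset.range h, X ^ i : K[X]).coeff 0 = 1 := by
    simp [coeff_X_pow, hh]
  rw [mul_coeff_zero, hG0, one_mul] at hA0
  rw [hq, hA0, C_1, mul_one]

/-- **Corollary.** Let `p` be a prime, and let `h, k` be positive integers with `p ∤ h` and
`2h ≤ k`. Suppose that the signed binomial coefficient `(-1)^i * C(k,i)` viewed modulo `p`
is a periodic function of `i` with period `h` in the range `0 ≤ i ≤ k`.
Then `k + 1` is a power of `p`. -/
theorem modular_periodicity_weaker (p h k : ℕ) (hp : p.Prime) (hh : 0 < h) (hk : 0 < k)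
    (hph : ¬ p ∣ h) (h2h : 2 * h ≤ k)
    (hper : ∀ i : ℕ, i + h ≤ k →
      ((k.choose (i + h) : ℤ) ≡ (-1) ^ h * (k.choose i) [ZMOD (p : ℤ)])) :
    ∃ r : ℕ, k + 1 = p ^ r := by
  have : Fact p.Prime := ⟨hp⟩
  set F : (ZMod p)[X] := (1 - X) ^ k with hF
  have hdeg : F.natDegree ≤ k := by
    rw [hF, natDegree_le_iff_coeff_eq_zero]
    intro i hi
    rw [coeff_one_sub_X_pow_eq, Nat.choose_eq_zero_of_lt hi, Nat.cast_zero, mul_zero]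
  have hF0 : F.coeff 0 = 1 := by simp [hF, coeff_one_sub_X_pow_eq]
  have hFper : ∀ i, i + h ≤ k → F.coeff (i + h) = F.coeff i := by
    intro i hi
    have h1 := (ZMod.intCast_eq_intCast_iff _ _ p).2 (hper i hi)
    push_cast at h1
    rw [hF, coeff_one_sub_X_pow_eq, coeff_one_sub_X_pow_eq, h1, pow_add, ← mul_assoc,
      mul_assoc ((-1) ^ i), ← mul_pow]
    simp
  have hdec := mul_one_sub_X_pow_of_periodic (by omega) hdeg hFper
  have hgeom : F * (1 - X ^ h) = (1 - X) ^ (k + 1) * ∑ i ∈ Finset.range h, X ^ i := by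
    rw [← mul_neg_geom_sum, pow_succ, mul_assoc]
  rw [hgeom] at hdec
  have hA := natDegree_sum_C_mul_X_pow_le F.coeff h
  have hB := natDegree_sum_C_mul_X_pow_le (fun i => F.coeff (k + 1 - h + i)) h
  have hh0 : (h : ZMod p) ≠ 0 := by rwa [Ne, ZMod.natCast_eq_zero_iff]
  have hAG := eq_geom_sum_of_dvd hh hA (by simp [coeff_X_pow, hh, hF0])
    (geom_sum_dvd_of_mul_derivative_eq hh0 (mul_derivative_eq_of_one_sub_X_pow hh h2h hA
      ((natDegree_neg _).trans_le hB) hdec))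
  have hone : ∀ i ≤ k, F.coeff i = 1 := by
    intro i
    induction i using Nat.strong_induction_on with
    | _ i ih =>
      intro hi
      by_cases hih : i < h
      · simpa [finsetSum_coeff, coeff_X_pow, hih] using congrArg (coeff · i) hAG
      · obtain ⟨j, rfl⟩ := Nat.exists_eq_add_of_le' (not_lt.1 hih)
        rw [hFper j hi, ih j (by omega) (by omega)]
  have hFsum : F = ∑ i ∈ Finset.range (k + 1), X ^ i := by
    rw [F.as_sum_range_C_mul_X_pow' (Nat.lt_succ_of_le hdeg)]
    refine Finset.sum_congr rfl fun i hi => ?_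
    rw [hone i (Nat.lt_succ_iff.1 (Finset.mem_range.1 hi)), C_1, one_mul]
  refine exists_eq_prime_pow_of_one_sub_X_pow k.succ_ne_zero ?_
  rw [pow_succ', ← hF, hFsum, mul_neg_geom_sum]
end

section
/- Let p be a prime, let h, k be positive integers, and let p^s be the highest power of p which divides h. Suppose that k ≥ 5·p^s, and that either 3(h - p^s) < 2(k+1), or p = 3 and 5(h - p^s) < 4(k+1). Suppose that the signed binomial coefficient (-1)^i * C(k,i) viewed modulo p is a periodic function of i with period h in the range 0 ≤ i ≤ k, i.e. C(k, i+h) ≡ (-1)^h * C(k,i) (mod p) for all integers i with 0 ≤ i ≤ k - h. Then p^t - p^s ≤ k < p^t for some nonnegative integer t. -/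
/-- A special case of the theorem of Lucas: multiplying the lower index by `p ^ s` amounts to dividing
the upper index by `p ^ s`. -/
theorem choose_pow_mul_modEq (p : ℕ) [Fact p.Prime] (s n i : ℕ) :
    n.choose (p ^ s * i) ≡ (n / p ^ s).choose i [MOD p] := by
  induction s generalizing n with
  | zero => simpa using Nat.ModEq.refl _
  | succ s ih =>
    have hp : 0 < p := (Fact.out : p.Prime).pos
    have key := Choose.choose_modEq_choose_mod_mul_choose_div_nat
      (p := p) (n := n) (k := p * (p ^ s * i))
    rw [Nat.mul_mod_right, Nat.mul_div_cancel_left _ hp, Nat.choose_zero_right, one_mul] at key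
    have hpow : n / p ^ (s + 1) = n / p / p ^ s := by rw [pow_succ', Nat.div_div_eq_div_mul]
    rw [hpow, pow_succ', mul_assoc]
    exact key.trans (ih (n / p))

/-- The case of a period prime to `p`: then `k + 1` is a power of `p`. -/
theorem exists_succ_eq_pow_of_periodic {p h k : ℕ} [Fact p.Prime] (hph : ¬ p ∣ h) (hk5 : 5 ≤ k)
    (hineq : 3 * (h - 1) < 2 * (k + 1) ∨ (p = 3 ∧ 5 * (h - 1) < 4 * (k + 1)))
    (hper : ∀ i : ℕ, i + h ≤ k → (k.choose (i + h) : ZMod p) = (-1) ^ h * k.choose i) :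
    ∃ t : ℕ, k + 1 = p ^ t := by
  have hp : p.Prime := Fact.out
  have hconst := choose_eq_neg_one_pow_of_periodic hph hper
  obtain ⟨a, m, hpm, hkm⟩ := Nat.exists_eq_pow_mul_and_not_dvd (Nat.succ_ne_zero k) p hp.ne_one
  rw [Nat.succ_eq_add_one] at hkm
  refine ⟨a, ?_⟩
  have hhk : h ≤ k := by omega
  have hodd : ¬ 2 ∣ m := by
    intro h2m
    have hkodd : Odd k := by
      have : 2 ∣ k + 1 := hkm ▸ h2m.mul_left _
      rw [Nat.odd_iff]; omega
    have hend := hper (k - h) (by omega)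
    rw [hconst (k - h) (by omega), ← pow_add, Nat.sub_add_cancel hhk,
      Nat.add_sub_cancel' hhk, hkodd.neg_one_pow, Nat.choose_self] at hend
    have h2 : ((2 : ℕ) : ZMod p) = 0 := by
      push_cast at hend ⊢
      linear_combination hend
    rw [ZMod.natCast_eq_zero_iff, Nat.prime_dvd_prime_iff_eq hp Nat.prime_two] at h2
    exact hpm (h2 ▸ h2m)
  have hqpos : 0 < p ^ a := pow_pos hp.pos a
  have hqh : k + 1 ≤ p ^ a + h := by
    by_contra! hlt
    have hvanish : (((k + 1).choose (p ^ a) : ℕ) : ZMod p) = 0 := by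
      obtain ⟨r, hr⟩ := Nat.exists_eq_succ_of_ne_zero hqpos.ne'
      rw [hr, Nat.succ_eq_add_one, Nat.choose_succ_succ', Nat.cast_add, hconst r (by omega),
        hconst (r + 1) (by omega)]
      ring
    have hlucas := choose_pow_mul_modEq p a (k + 1) 1
    rw [mul_one, Nat.choose_one_right, hkm, Nat.mul_div_cancel_left _ hqpos,
      ← ZMod.natCast_eq_natCast_iff, ← hkm, hvanish] at hlucas
    exact hpm ((ZMod.natCast_eq_zero_iff _ _).mp hlucas.symm)
  have hqp : p ^ a = 1 ∨ p ∣ p ^ a := by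
    cases a with
    | zero => exact Or.inl (pow_zero p)
    | succ a => exact Or.inr (dvd_pow_self p a.succ_ne_zero)
  generalize p ^ a = q at *
  obtain rfl | hm3 : m = 1 ∨ 3 ≤ m := by omega
  · simpa using hkm
  exfalso
  obtain hineq | ⟨rfl, hineq⟩ := hineq
  · obtain rfl | hm5 : m = 3 ∨ 5 ≤ m := by omega
    · obtain hq | hq := hqp
      · omega
      · exact hph ((show h = q * 2 by omega) ▸ hq.mul_right 2)
    · have := Nat.mul_le_mul_left q hm5
      obtain rfl : q = 1 := by omega
      omega
  · obtain rfl | hm7 : m = 5 ∨ 7 ≤ m := by omega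
    · omega
    · have := Nat.mul_le_mul_left q hm7
      obtain rfl : q = 1 := by omega
      obtain rfl | rfl : m = 7 ∨ m = 9 := by omega
      all_goals omega

/-- **Corollary.** Let `p` be a prime, let `h, k` be positive integers, and let `p^s` be the
highest power of `p` dividing `h`. Suppose `k ≥ 5·p^s`, and that either `3(h - p^s) < 2(k+1)`,
or `p = 3` and `5(h - p^s) < 4(k+1)`. Suppose that `(-1)^i * C(k,i) (mod p)` is a periodic
function of `i` with period `h` in the range `0 ≤ i ≤ k`. Then `p^t - p^s ≤ k < p^t` for some
nonnegative integer `t`. -/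
theorem modular_periodicity_general (p h k s : ℕ) (hp : p.Prime) (hh : 0 < h) (hk : 0 < k)
    (hs : p ^ s ∣ h) (hs' : ¬ p ^ (s + 1) ∣ h)
    (hk5 : 5 * p ^ s ≤ k)
    (hineq : 3 * (h - p ^ s) < 2 * (k + 1) ∨ (p = 3 ∧ 5 * (h - p ^ s) < 4 * (k + 1)))
    (hper : ∀ i : ℕ, i + h ≤ k →
      ((k.choose (i + h) : ℤ) ≡ (-1) ^ h * (k.choose i) [ZMOD (p : ℤ)])) :
    ∃ t : ℕ, (p : ℤ) ^ t - (p : ℤ) ^ s ≤ (k : ℤ) ∧ (k : ℤ) < (p : ℤ) ^ t := by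
  have : Fact p.Prime := ⟨hp⟩
  have hqpos : 0 < p ^ s := pow_pos hp.pos s
  obtain ⟨h', rfl⟩ := hs
  have hph : ¬ p ∣ h' := fun hdvd => hs' (pow_succ p s ▸ Nat.mul_dvd_mul_left _ hdvd)
  have hlt : k + 1 ≤ p ^ s * (k / p ^ s + 1) := Nat.lt_mul_div_succ k hqpos
  have hle : p ^ s * (k / p ^ s) ≤ k := Nat.mul_div_le k _
  have hsub : p ^ s * h' - p ^ s = p ^ s * (h' - 1) := by rw [Nat.mul_sub, mul_one]
  obtain ⟨t, ht⟩ := exists_succ_eq_pow_of_periodic (p := p) (h := h') (k := k / p ^ s) hph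
    ((Nat.le_div_iff_mul_le hqpos).mpr hk5)
    (by
      rw [hsub] at hineq
      refine hineq.imp (fun hi => ?_) (And.imp_right fun hi => ?_) <;>
      · refine lt_of_mul_lt_mul_left (a := p ^ s) ?_ hqpos.le
        linarith)
    (fun i hi => by
      have hcast := (ZMod.intCast_eq_intCast_iff _ _ _).mpr (hper (p ^ s * i)
        (by rw [← mul_add]; exact (Nat.mul_le_mul_left _ hi).trans hle))
      push_cast at hcast
      rwa [← mul_add, pow_mul, ZMod.pow_card_pow,
        (ZMod.natCast_eq_natCast_iff _ _ _).mpr (choose_pow_mul_modEq p s k (i + h')),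
        (ZMod.natCast_eq_natCast_iff _ _ _).mpr (choose_pow_mul_modEq p s k i)] at hcast)
  refine ⟨s + t, ?_, ?_⟩
  · have hz : ((p ^ s * (k / p ^ s) + p ^ s : ℕ) : ℤ) = (p : ℤ) ^ (s + t) := by
      rw [← Nat.mul_succ, Nat.succ_eq_add_one, ht, ← pow_add, Nat.cast_pow]
    rw [← hz]
    push_cast
    have : ((p ^ s * (k / p ^ s) : ℕ) : ℤ) ≤ k := by exact_mod_cast hle
    push_cast at this
    linarith
  · rw [ht, ← pow_add] at hlt
    exact_mod_cast hlt
end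

section
/- Let G be a multiplicative subgroup of a finite field F_q which generates F_q as a field, and let H be a proper subgroup of G. Suppose that 1 - α ∈ G for all α ∈ G \ H. Then G is the whole multiplicative group F_q^* of nonzero elements of F_q. -/
open Polynomial

/-- Coefficient form of `X ^ n - 1 ∣ (X ^ m - 1) * P`: away from the constant term the
coefficients of `P` are `m`-periodic up to degree `n`. -/
lemma coeff_add_eq_of_X_pow_sub_one_dvd {R : Type*} [CommRing R] [IsDomain R] {m n : ℕ}
    (hm : 0 < m) (hmn : m < n) {P : R[X]} (hP : P.natDegree ≤ n) (hP0 : P.coeff 0 = 0)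
    (hdvd : (X ^ n - 1 : R[X]) ∣ (X ^ m - 1) * P) {i : ℕ} (hi : 0 < i) (him : i + m ≤ n) :
    P.coeff (i + m) = P.coeff i := by
  obtain ⟨Q, hQ⟩ := hdvd
  have hQdeg : Q.natDegree ≤ m := by
    by_cases hQ0 : Q = 0
    · simp [hQ0]
    have hn : (X ^ n - 1 : R[X]).natDegree = n := natDegree_X_pow_sub_C (r := 1)
    have hn0 : (X ^ n - 1 : R[X]) ≠ 0 := X_pow_sub_C_ne_zero (hm.trans hmn) 1
    have hm' : (X ^ m - 1 : R[X]).natDegree = m := natDegree_X_pow_sub_C (r := 1)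
    have h1 := natDegree_mul hn0 hQ0
    have h2 := natDegree_mul_le (p := (X ^ m - 1 : R[X])) (q := P)
    rw [hQ] at h2
    omega
  have hcoeff (j : ℕ) := congrArg (fun p : R[X] => p.coeff j) hQ
  simp only [sub_mul, one_mul, coeff_sub, coeff_X_pow_mul'] at hcoeff
  have h0 := hcoeff 0
  simp only [nonpos_iff_eq_zero, hm.ne', (hm.trans hmn).ne', if_false, hP0] at h0
  have h1 := hcoeff (i + m)
  rw [if_pos (by omega), coeff_eq_zero_of_natDegree_lt (p := Q) (n := i + m) (by omega),
    Nat.add_sub_cancel] at h1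
  split_ifs at h1 with h
  · rw [show i + m - n = 0 by omega] at h1
    linear_combination -h0 - h1
  · linear_combination -h1

lemma coeff_one_sub_X_pow {R : Type*} [CommRing R] (n i : ℕ) :
    ((1 - X : R[X]) ^ n).coeff i = (-1) ^ i * n.choose i := by
  have h : (1 - X : R[X]) ^ n = ((1 + X) ^ n).comp (C (-1) * X) := by
    simp [sub_eq_add_neg]
  rw [h, comp_C_mul_X_coeff, coeff_one_add_X_pow, mul_comm]

/-- If the signed binomial coefficients `(-1) ^ i * n.choose i` with `0 < i ≤ n` are `m`-periodic
in a field where `m` and `n` are invertible, then they are all equal to `1`. -/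
lemma neg_one_pow_mul_choose_eq_one {F : Type*} [Field F] {m n : ℕ} (hm : 0 < m) (hmn : 2 * m ≤ n)
    (hmF : (m : F) ≠ 0) (hnF : (n : F) ≠ 0)
    (hper : ∀ i, 0 < i → i + m ≤ n →
      (-1 : F) ^ (i + m) * n.choose (i + m) = (-1) ^ i * n.choose i)
    {i : ℕ} (hi : i ≤ n) : (-1 : F) ^ i * n.choose i = 1 := by
  have hrec (j : ℕ) (hj : j ≤ n) : ((j : F) + 1) * ((-1) ^ (j + 1) * n.choose (j + 1)) =
      (j - n) * ((-1) ^ j * n.choose j) := by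
    have h := congrArg (Nat.cast : ℕ → F) (Nat.choose_succ_right_eq n j)
    push_cast [Nat.cast_sub hj] at h
    linear_combination (-1) ^ (j + 1) * h
  have hstep (j : ℕ) (hj : 0 < j) (hjn : j + 1 + m ≤ n) :
      (-1 : F) ^ (j + 1) * n.choose (j + 1) = (-1) ^ j * n.choose j := by
    have h1 := hrec j (by omega)
    have h2 := hrec (j + m) (by omega)
    rw [show j + m + 1 = j + 1 + m by ring, hper (j + 1) (by omega) hjn,
      hper j hj (by omega)] at h2
    push_cast at h2
    apply mul_left_cancel₀ hmF
    linear_combination h2 - h1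
  have hconst (j : ℕ) (hj : 0 < j) (hjn : j ≤ n) : (-1 : F) ^ j * n.choose j = -n := by
    induction j using Nat.strong_induction_on with
    | _ j ih =>
      by_cases h1 : j = 1
      · simp [h1]
      by_cases h2 : j + m ≤ n
      · obtain ⟨k, rfl⟩ : ∃ k, j = k + 1 := ⟨j - 1, by omega⟩
        rw [hstep k (by omega) h2, ih k (by omega) (by omega) (by omega)]
      · obtain ⟨k, rfl⟩ : ∃ k, j = k + m := ⟨j - m, by omega⟩
        by_cases hk : 0 < k
        · rw [hper k hk hjn, ih k (by omega) hk (by omega)]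
        · omega
  have hn1 : (n : F) = -1 := by
    have h := hrec 1 (by omega)
    rw [hconst (1 + 1) (by omega) (by omega), hconst 1 (by omega) (by omega)] at h
    apply mul_left_cancel₀ hnF
    push_cast at h
    linear_combination -h
  rcases Nat.eq_zero_or_pos i with rfl | h
  · simp
  · rw [hconst i h hi, hn1, neg_neg]

lemma sub_pow_succ_of_choose {R : Type*} [CommRing R] {n : ℕ}
    (h : ∀ i ≤ n, (-1 : R) ^ i * n.choose i = 1) (a b : R) :
    (a - b) ^ (n + 1) = a ^ (n + 1) - b ^ (n + 1) := by
  have hsum : (a - b) ^ n = ∑ i ∈ Finset.range (n + 1), a ^ i * b ^ (n + 1 - 1 - i) := by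
    rw [sub_eq_add_neg, add_pow]
    refine Finset.sum_congr rfl fun i hi => ?_
    have hin : i ≤ n := Finset.mem_range_succ_iff.mp hi
    have hc := h (n - i) (Nat.sub_le n i)
    rw [Nat.choose_symm hin] at hc
    rw [neg_pow b, Nat.add_sub_cancel]
    linear_combination a ^ i * b ^ (n - i) * hc
  rw [pow_succ, hsum, (Commute.all a b).geom_sum₂_mul]

lemma natCast_ne_zero_of_dvd_card_units {F : Type*} [Field F] [Fintype F] {n : ℕ}
    (h : n ∣ Nat.card Fˣ) : (n : F) ≠ 0 := by
  classical
  obtain ⟨t, ht⟩ := h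
  rw [Nat.card_eq_fintype_card, Fintype.card_units] at ht
  have hq : (Fintype.card F : F) = 0 := FiniteField.cast_card_eq_zero F
  rw [show Fintype.card F = n * t + 1 by have := Fintype.card_pos (α := F); omega] at hq
  intro h0
  simp [h0] at hq

lemma exists_isPrimitiveRoot_card {F : Type*} [Field F] [Finite F] (G : Subgroup Fˣ) :
    ∃ ζ ∈ G, IsPrimitiveRoot (ζ : F) (Nat.card G) := by
  obtain ⟨g, hg⟩ := IsCyclic.exists_ofOrder_eq_natCard (α := G)
  refine ⟨g, g.2, ?_⟩
  rw [IsPrimitiveRoot.coe_units_iff, ← hg, ← Subgroup.orderOf_coe]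
  exact IsPrimitiveRoot.orderOf _

lemma mem_of_pow_card_eq_one {F : Type*} [Field F] [Finite F] {G : Subgroup Fˣ} {u : Fˣ}
    (hu : u ^ Nat.card G = 1) : u ∈ G := by
  obtain ⟨ζ, hζG, hζ⟩ := exists_isPrimitiveRoot_card G
  have : NeZero (Nat.card G) := ⟨Nat.card_pos.ne'⟩
  obtain ⟨i, -, hi⟩ := hζ.eq_pow_of_pow_eq_one (ξ := (u : F)) (by simpa using congrArg Units.val hu)
  rw [show u = ζ ^ i from Units.ext (by simpa using hi.symm)]
  exact pow_mem hζG i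

lemma coe_pow_card_eq_one {M : Type*} [Monoid M] {G : Subgroup Mˣ} {u : Mˣ} (hu : u ∈ G) :
    (u : M) ^ Nat.card G = 1 := by
  have h : (⟨u, hu⟩ : G) ^ Nat.card G = 1 := pow_card_eq_one'
  exact congrArg (fun g : G => ((g : Mˣ) : M)) h

lemma X_pow_card_sub_one_dvd {F : Type*} [Field F] [Finite F] {G : Subgroup Fˣ} {P : F[X]}
    (h : ∀ u ∈ G, P.eval (u : F) = 0) : (X ^ Nat.card G - 1 : F[X]) ∣ P := by
  obtain ⟨ζ, hζG, hζ⟩ := exists_isPrimitiveRoot_card G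
  rw [X_pow_sub_one_eq_prod Nat.card_pos hζ]
  refine Finset.prod_dvd_of_coprime
    (fun x _ y _ hxy => pairwise_coprime_X_sub_C Function.injective_id hxy) fun x hx => ?_
  rw [mem_nthRootsFinset Nat.card_pos] at hx
  have hx0 : x ≠ 0 := by
    rintro rfl
    simp [Nat.card_pos.ne'] at hx
  rw [dvd_iff_isRoot]
  exact h (Units.mk0 x hx0) (mem_of_pow_card_eq_one (Units.ext (by simpa using hx)))

/-- **Theorem.** Let `G` be a multiplicative subgroup of a finite field `F_q` which generates
`F_q` as a field, and let `H` be a proper subgroup of `G`. Suppose that `1 - α ∈ G` for all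
`α ∈ G \ H`. Then `G = F_q^*`. -/
theorem near_field_theorem (F : Type*) [Field F] [Fintype F] (G H : Subgroup Fˣ)
    (hgen : Subfield.closure ((fun u : Fˣ => (u : F)) '' (G : Set Fˣ)) = ⊤)
    (hHG : H < G)
    (hyp : ∀ α : Fˣ, α ∈ G → α ∉ H → ∃ β ∈ G, (β : F) = 1 - (α : F)) :
    G = ⊤ := by
  have hm : 0 < Nat.card H := Nat.card_pos
  have hmn : 2 * Nat.card H ≤ Nat.card G := by
    obtain ⟨k, hk⟩ := Subgroup.card_dvd_of_le hHG.le
    have hk0 : k ≠ 0 := by rintro rfl; simp [Nat.card_pos.ne'] at hk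
    have hk1 : k ≠ 1 := by
      rintro rfl
      exact hHG.ne (Subgroup.eq_of_le_of_card_ge hHG.le (by omega))
    rw [hk, mul_comm]
    exact Nat.mul_le_mul_left _ (by omega)
  have hdvd : (X ^ Nat.card G - 1 : F[X]) ∣
      (X ^ Nat.card H - 1) * ((1 - X) ^ Nat.card G - 1) := by
    refine X_pow_card_sub_one_dvd fun u hu => ?_
    by_cases huH : u ∈ H
    · simp [coe_pow_card_eq_one huH]
    · obtain ⟨β, hβ, hβu⟩ := hyp u hu huH
      simp [← hβu, coe_pow_card_eq_one hβ]
  have hper (i : ℕ) (hi : 0 < i) (hin : i + Nat.card H ≤ Nat.card G) :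
      (-1 : F) ^ (i + Nat.card H) * (Nat.card G).choose (i + Nat.card H) =
        (-1) ^ i * (Nat.card G).choose i := by
    have h := coeff_add_eq_of_X_pow_sub_one_dvd hm (by omega) (by compute_degree)
      (by simp [coeff_zero_eq_eval_zero]) hdvd hi hin
    simpa [coeff_one_sub_X_pow, coeff_one, hi.ne', hm.ne'] using h
  have hsub := sub_pow_succ_of_choose fun i hi => neg_one_pow_mul_choose_eq_one hm hmn
    (natCast_ne_zero_of_dvd_card_units H.card_subgroup_dvd_card)
    (natCast_ne_zero_of_dvd_card_units G.card_subgroup_dvd_card) hper hi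
  have hall (x : F) : x ^ (Nat.card G + 1) = x := by
    have hx : x ∈ Subfield.closure ((fun u : Fˣ => (u : F)) '' (G : Set Fˣ)) := hgen ▸ trivial
    induction hx using Subfield.closure_induction with
    | mem x hx =>
      obtain ⟨u, hu, rfl⟩ := hx
      simp [pow_succ, coe_pow_card_eq_one hu]
    | one => simp
    | add x y _ _ hx hy =>
      have h := hsub x (0 - y)
      rwa [hsub 0 y, hx, hy, zero_pow (Nat.succ_ne_zero _), zero_sub, sub_neg_eq_add] at h
    | neg x _ hx =>
      have h := hsub 0 x
      rwa [hx, zero_pow (Nat.succ_ne_zero _), zero_sub] at h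
    | inv x _ hx => rw [inv_pow, hx]
    | mul x y _ _ hx hy => rw [mul_pow, hx, hy]
  refine eq_top_iff.mpr fun u _ => mem_of_pow_card_eq_one (Units.ext ?_)
  have := hall u
  rw [pow_succ] at this
  simpa using this
end

section
/- Let F be any field, let G be a multiplicative subgroup of F^*, and let H be a finite proper subgroup of G. Suppose that 1 - α ∈ G for all α ∈ G \ H. Then 1 - α ∈ G for all α ∈ G \ {1}. -/
/-- **Lemma (Leep–Shapiro).** Let `F` be any field, let `G` be a multiplicative subgroup of
`F^*` and let `H` be a finite proper subgroup of `G`. Suppose that `1 - α ∈ G` for all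
`α ∈ G \ H`. Then `1 - α ∈ G` for all `α ∈ G \ {1}`. -/
theorem leep_shapiro_lemma (F : Type*) [Field F] (G H : Subgroup Fˣ)
    (hHfin : (H : Set Fˣ).Finite) (hHG : H < G)
    (hyp : ∀ α : Fˣ, α ∈ G → α ∉ H → ∃ β ∈ G, (β : F) = 1 - (α : F)) :
    ∀ α : Fˣ, α ∈ G → α ≠ 1 → ∃ β ∈ G, (β : F) = 1 - (α : F) := by
  intro α hαG hα1
  by_cases hαH : α ∈ H
  swap
  · exact hyp α hαG hαH
  by_contra hno
  obtain ⟨g, hgG, hgH⟩ := SetLike.exists_of_lt hHG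
  have hα1F : (α : F) ≠ 1 := fun h => hα1 (Units.ext h)
  -- If no `β` exists, then `h ↦ (α - g h) / (1 - g h)` maps `H` to itself.
  have key : ∀ h : H, ∃ k : H, ((k : Fˣ) : F) * (1 - g * (h : Fˣ)) = α - g * (h : Fˣ) := by
    rintro ⟨h, hh⟩
    have hhG := hHG.le hh
    have hgh : g * h ∉ H := fun hc => hgH ((H.mul_mem_cancel_right hh).1 hc)
    have hagh : α⁻¹ * (g * h) ∉ H := fun hc =>
      hgh ((H.mul_mem_cancel_left (H.inv_mem hαH)).1 hc)
    obtain ⟨b, hbG, hb⟩ := hyp _ (G.mul_mem hgG hhG) hgh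
    obtain ⟨c, hcG, hc⟩ := hyp _ (G.mul_mem (G.inv_mem hαG) (G.mul_mem hgG hhG)) hagh
    push_cast at hb hc
    have hc' : (α : F) * c = α - g * h := by
      rw [hc]; field_simp
    have hkH : α * c * b⁻¹ ∈ H := by
      by_contra hk
      obtain ⟨d, hdG, hd⟩ := hyp _ (G.mul_mem (G.mul_mem hαG hcG) (G.inv_mem hbG)) hk
      refine hno ⟨b * d, G.mul_mem hbG hdG, ?_⟩
      push_cast at hd ⊢
      have : (b : F) * d = b - α * c := by
        rw [hd]; field_simp
      rw [this, hc', hb]; ring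
    refine ⟨⟨_, hkH⟩, ?_⟩
    rw [← hb, ← hc']; push_cast; field_simp
  choose f hf using key
  have hinj : Function.Injective f := by
    intro x y hxy
    have hx := hf x
    have hy := hf y
    rw [hxy] at hx
    have hmul : ((α : F) - 1) * (g * ((x : Fˣ) - (y : Fˣ))) = 0 := by
      linear_combination (1 - (g : F) * (x : Fˣ)) * hy - (1 - (g : F) * (y : Fˣ)) * hx
    have hsub : ((x : Fˣ) : F) - (y : Fˣ) = 0 := by
      simpa [sub_ne_zero.2 hα1F] using hmul
    exact Subtype.ext (Units.ext (sub_eq_zero.1 hsub))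
  have : Finite H := hHfin
  obtain ⟨x, hx⟩ := Finite.surjective_of_injective hinj 1
  have hfx := hf x
  rw [hx] at hfx
  apply hα1F
  push_cast at hfx
  linear_combination -hfx
end

section
/- Let F be any field, let G be a multiplicative subgroup of F^*, and let H be a finite proper subgroup of G. If 1 - α ∈ G for all α ∈ G \ H, then G ∪ {0} is a subfield of F (i.e., G ∪ {0} is closed under addition, subtraction, multiplication, and contains the multiplicative inverses of its nonzero elements). -/
/-- A subgroup `G` of `Fˣ` containing `1 - α` for every `α ∈ G` outside a proper subgroup `H`
contains `-1`. -/
theorem neg_one_mem_of_one_sub_mem {F : Type*} [Field F] {G H : Subgroup Fˣ} (hHG : H < G)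
    (hyp : ∀ α : Fˣ, α ∈ G → α ∉ H → ∃ β ∈ G, (β : F) = 1 - (α : F)) : (-1 : Fˣ) ∈ G := by
  obtain ⟨g, hg, hgH⟩ := SetLike.exists_of_lt hHG
  obtain ⟨b, hb, hb'⟩ := hyp g hg hgH
  obtain ⟨c, hc, hc'⟩ := hyp g⁻¹ (G.inv_mem hg) (by simpa using hgH)
  have h : (-1 : Fˣ) = c * g * b⁻¹ := by
    rw [eq_mul_inv_iff_mul_eq]
    ext
    push_cast at hc' ⊢
    rw [hb', hc', sub_mul, inv_mul_cancel₀ g.ne_zero]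
    ring
  rw [h]
  exact G.mul_mem (G.mul_mem hc hg) (G.inv_mem hb)

/-- If `H` is a finite proper subgroup of `G` and `1 - α ∈ G` for all `α ∈ G \ H`, then
`1 - h ∈ G` also for all `h ∈ H` other than `1`. Otherwise, for `g ∈ G \ H`, the map
`k ↦ (1 - g k) / (h - g k)` would be an injection of the finite set `H` into `H \ {1}`. -/
theorem one_sub_mem_of_mem_finite_subgroup {F : Type*} [Field F] {G H : Subgroup Fˣ}
    (hHfin : (H : Set Fˣ).Finite) (hHG : H < G)
    (hyp : ∀ α : Fˣ, α ∈ G → α ∉ H → ∃ β ∈ G, (β : F) = 1 - (α : F))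
    {h : Fˣ} (hh : h ∈ H) (h1 : h ≠ 1) : ∃ β ∈ G, (β : F) = 1 - (h : F) := by
  by_contra hcon
  obtain ⟨g, hg, hgH⟩ := SetLike.exists_of_lt hHG
  have h1' : (h : F) ≠ 1 := by simpa using h1
  have key : ∀ k : H, ∃ c : H, ((c : Fˣ) : F) * (h - g * (k : Fˣ)) = 1 - g * (k : Fˣ) := by
    rintro ⟨k, hk⟩
    have hgk : g * k ∉ H := fun hm => hgH ((H.mul_mem_cancel_right hk).1 hm)
    have hgkh : g * k * h⁻¹ ∉ H := fun hm =>
      hgk ((H.mul_mem_cancel_right (H.inv_mem hh)).1 hm)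
    have hgkG : g * k ∈ G := G.mul_mem hg (hHG.le hk)
    obtain ⟨b, hb, hb'⟩ := hyp _ hgkG hgk
    obtain ⟨c, hc, hc'⟩ := hyp _ (G.mul_mem hgkG (G.inv_mem (hHG.le hh))) hgkh
    have hd : ((h * c : Fˣ) : F) = h - g * k := by
      push_cast at hc' ⊢
      rw [hc']
      field_simp
    have hhc : h * c ∈ G := G.mul_mem (hHG.le hh) hc
    by_cases hm : b * (h * c)⁻¹ ∈ H
    · refine ⟨⟨_, hm⟩, ?_⟩
      rw [← hd, ← Units.val_mul, inv_mul_cancel_right, hb', Units.val_mul]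
    · have hm' : h * c * b⁻¹ ∉ H := fun hx => hm (by simpa using H.inv_mem hx)
      obtain ⟨d, hdG, hd'⟩ := hyp _ (G.mul_mem hhc (G.inv_mem hb)) hm'
      refine absurd ⟨b * d, G.mul_mem hb hdG, ?_⟩ hcon
      rw [Units.val_mul, hd', mul_sub, mul_one, ← Units.val_mul, mul_comm b,
        inv_mul_cancel_right, hd, hb', Units.val_mul]
      ring
  choose f hf using key
  have : Finite H := hHfin
  have hinj : Function.Injective f := by
    intro k l hkl
    have hk := hf k
    have hl := hf l
    rw [hkl] at hk
    have hprod : (((f l : Fˣ) : F) - 1) * (g * ((k : Fˣ) - (l : Fˣ))) = 0 := by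
      linear_combination hl - hk
    rcases mul_eq_zero.1 hprod with h0 | h0
    · rw [sub_eq_zero.1 h0] at hl
      exact absurd (by linear_combination hl) h1'
    · have := (mul_eq_zero.1 h0).resolve_left g.ne_zero
      exact Subtype.ext (Units.ext (sub_eq_zero.1 this))
  obtain ⟨k, hk⟩ := Finite.surjective_of_injective hinj 1
  have := hf k
  rw [hk] at this
  push_cast at this
  exact h1' (by linear_combination this)

/-- **Theorem.** Let `F` be any field, let `G` be a multiplicative subgroup of `F^*` and let
`H` be a finite proper subgroup of `G`. If `1 - α ∈ G` for all `α ∈ G \ H`, then `G ∪ {0}`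
is a subfield of `F`. -/
theorem near_field_general (F : Type*) [Field F] (G H : Subgroup Fˣ)
    (hHfin : (H : Set Fˣ).Finite) (hHG : H < G)
    (hyp : ∀ α : Fˣ, α ∈ G → α ∉ H → ∃ β ∈ G, (β : F) = 1 - (α : F)) :
    ∃ K : Subfield F, (K : Set F) = {x : F | x = 0 ∨ ∃ g ∈ G, ((g : Fˣ) : F) = x} := by
  have hneg : (-1 : Fˣ) ∈ G := neg_one_mem_of_one_sub_mem hHG hyp
  have hneg' : ∀ g ∈ G, -g ∈ G := fun g hg => by simpa using G.mul_mem hneg hg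
  have hsub : ∀ α ∈ G, α ≠ 1 → ∃ β ∈ G, (β : F) = 1 - (α : F) := fun α hα hα1 => by
    by_cases hαH : α ∈ H
    · exact one_sub_mem_of_mem_finite_subgroup hHfin hHG hyp hαH hα1
    · exact hyp α hα hαH
  refine ⟨{ carrier := {x : F | x = 0 ∨ ∃ g ∈ G, ((g : Fˣ) : F) = x}
            mul_mem' := ?_, one_mem' := Or.inr ⟨1, G.one_mem, Units.val_one⟩
            add_mem' := ?_, zero_mem' := Or.inl rfl
            neg_mem' := ?_, inv_mem' := ?_ }, rfl⟩
  · rintro _ _ (rfl | ⟨a, ha, rfl⟩) (rfl | ⟨b, hb, rfl⟩)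
    · simp
    · simp
    · simp
    · exact Or.inr ⟨a * b, G.mul_mem ha hb, Units.val_mul a b⟩
  · rintro _ _ (rfl | ⟨a, ha, rfl⟩) (rfl | ⟨b, hb, rfl⟩)
    · simp
    · exact Or.inr ⟨b, hb, (zero_add _).symm⟩
    · exact Or.inr ⟨a, ha, (add_zero _).symm⟩
    · by_cases hab : -b * a⁻¹ = 1
      · left
        rw [mul_inv_eq_one] at hab
        rw [← hab]
        simp
      · obtain ⟨c, hc, hc'⟩ := hsub _ (G.mul_mem (hneg' b hb) (G.inv_mem ha)) hab
        refine Or.inr ⟨a * c, G.mul_mem ha hc, ?_⟩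
        rw [Units.val_mul, hc']
        push_cast
        field_simp
        ring
  · rintro _ (rfl | ⟨a, ha, rfl⟩)
    · simp
    · exact Or.inr ⟨-a, hneg' a ha, Units.val_neg a⟩
  · rintro _ (rfl | ⟨a, ha, rfl⟩)
    · simp
    · exact Or.inr ⟨a⁻¹, G.inv_mem ha, Units.val_inv_eq_inv_val a⟩
end

section
/- Let G be a multiplicative subgroup of the finite field F_q, and suppose that |G ∩ (1 - G)| ≥ |G| / 2, where 1 - G = {1 - g : g ∈ G}. Then either G = F_q^* or |G| < 2·√q. -/
open Finset

/-- A Jacobi sum of two characters that are nontrivial and have nontrivial product has absolute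
value the square root of the cardinality of the field. -/
theorem norm_jacobiSum_eq_sqrt_card {F : Type*} [Field F] [Fintype F] {χ φ : MulChar F ℂ}
    (hχ : χ ≠ 1) (hφ : φ ≠ 1) (hχφ : χ * φ ≠ 1) :
    ‖jacobiSum χ φ‖ = Real.sqrt (Fintype.card F) := by
  have hchar : ringChar ℂ ≠ ringChar F := by
    rw [ringChar.eq_zero]
    exact (CharP.ringChar_ne_zero_of_finite F).symm
  have hconj : jacobiSum χ⁻¹ φ⁻¹ = star (jacobiSum χ φ) := by
    simp only [jacobiSum, star_sum, star_mul', MulChar.star_apply']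
  have h := jacobiSum_mul_jacobiSum_inv hchar hχ hφ hχφ
  rw [hconj] at h
  have h' := congrArg norm h
  rw [norm_mul, norm_star, Complex.norm_natCast] at h'
  rw [← h', Real.sqrt_mul_self (norm_nonneg _)]

/-- A subgroup of the unit group of a finite field is the kernel of any multiplicative character
whose order is the index of the subgroup. -/
theorem MulChar.apply_eq_one_iff_mem_of_orderOf_eq_index {F : Type*} [Field F] [Finite F]
    {G : Subgroup Fˣ} {χ : MulChar F ℂ} (hχ : orderOf χ = G.index) (a : Fˣ) :
    χ a = 1 ↔ a ∈ G := by
  constructor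
  · intro ha
    obtain ⟨γ, hγ⟩ := IsCyclic.exists_generator (α := Fˣ)
    obtain ⟨k, rfl⟩ := mem_powers_iff_mem_zpowers.mpr (hγ a)
    have hk : χ ^ k = 1 := by
      rw [MulChar.eq_iff hγ, MulChar.pow_apply_coe, MulChar.one_apply_coe, ← ha]
      simp
    obtain ⟨l, rfl⟩ := hχ ▸ orderOf_dvd_of_pow_eq_one hk
    change γ ^ (G.index * l) ∈ G
    rw [pow_mul]
    exact G.pow_mem (G.pow_index_mem γ) l
  · intro ha
    have hle : (powMonoidHom G.index : Fˣ →* Fˣ).range ≤ G := by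
      rintro _ ⟨b, rfl⟩
      exact G.pow_index_mem b
    have hidx : (powMonoidHom G.index : Fˣ →* Fˣ).range.index = G.index := by
      rw [IsCyclic.index_powMonoidHom_range]
      exact Nat.gcd_eq_right G.index_dvd_card
    have hrel := Subgroup.relIndex_mul_index hle
    rw [hidx] at hrel
    have hone : (powMonoidHom G.index : Fˣ →* Fˣ).range.relIndex G = 1 :=
      Nat.eq_of_mul_eq_mul_right (Nat.pos_of_ne_zero G.index_ne_zero_of_finite)
        (hrel.trans (one_mul _).symm)
    obtain ⟨b, rfl⟩ := Subgroup.relIndex_eq_one.mp hone ha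
    rw [powMonoidHom_apply, Units.val_pow_eq_pow_val, map_pow, ← MulChar.pow_apply_coe, ← hχ,
      pow_orderOf_eq_one, MulChar.one_apply_coe]

/-- The powers of a character whose order is the index of `G` sum to `G.index` times the indicator
function of `G`. -/
theorem MulChar.sum_range_index_pow_apply {F : Type*} [Field F] [Finite F]
    {G : Subgroup Fˣ} {χ : MulChar F ℂ} (hχ : orderOf χ = G.index) (x : F)
    [Decidable (∃ g ∈ G, ((g : Fˣ) : F) = x)] :
    ∑ i ∈ range G.index, (χ ^ i) x =
      if ∃ g ∈ G, ((g : Fˣ) : F) = x then (G.index : ℂ) else 0 := by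
  rcases eq_or_ne x 0 with rfl | hx
  · simp
  lift x to Fˣ using hx.isUnit
  have hmem : (∃ g ∈ G, ((g : Fˣ) : F) = x) ↔ χ x = 1 := by
    simp [MulChar.apply_eq_one_iff_mem_of_orderOf_eq_index hχ, Units.val_inj]
  simp only [hmem, MulChar.pow_apply_coe]
  split_ifs with h
  · simp [h]
  · have hpow : χ x ^ G.index = 1 := by
      rw [← MulChar.pow_apply_coe, ← hχ, pow_orderOf_eq_one, MulChar.one_apply_coe]
    rw [geom_sum_eq h, hpow, sub_self, zero_div]

/-- The number of elements of `G ∩ (1 - G)` as a sum of Jacobi sums. -/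
theorem sum_jacobiSum_eq_index_sq_mul_card {F : Type*} [Field F] [Fintype F]
    {G : Subgroup Fˣ} {χ : MulChar F ℂ} (hχ : orderOf χ = G.index) :
    ∑ i ∈ range G.index, ∑ j ∈ range G.index, jacobiSum (χ ^ i) (χ ^ j) =
      (G.index : ℂ) ^ 2 * Nat.card {x : F // (∃ g ∈ G, ((g : Fˣ) : F) = x) ∧
        ∃ g ∈ G, ((g : Fˣ) : F) = 1 - x} := by
  classical
  calc ∑ i ∈ range G.index, ∑ j ∈ range G.index, jacobiSum (χ ^ i) (χ ^ j)
      = ∑ x : F, (∑ i ∈ range G.index, (χ ^ i) x) * ∑ j ∈ range G.index, (χ ^ j) (1 - x) := by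
        simp only [sum_mul_sum, jacobiSum]
        rw [sum_comm (s := univ)]
        exact sum_congr rfl fun i _ ↦ sum_comm
    _ = _ := by
        simp only [MulChar.sum_range_index_pow_apply hχ]
        rw [Nat.card_eq_fintype_card, Fintype.card_subtype, card_filter, Nat.cast_sum, mul_sum]
        refine sum_congr rfl fun x _ ↦ ?_
        by_cases h₁ : ∃ g ∈ G, ((g : Fˣ) : F) = x <;>
          by_cases h₂ : ∃ g ∈ G, ((g : Fˣ) : F) = 1 - x <;> simp [h₁, h₂, sq]

/-- An upper bound for the sum of the Jacobi sums of all pairs of powers of a character. -/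
theorem re_sum_jacobiSum_pow_le {F : Type*} [Field F] [Fintype F] {χ : MulChar F ℂ} {n : ℕ}
    (hχ : orderOf χ = n + 1) :
    (∑ i ∈ range (n + 1), ∑ j ∈ range (n + 1), jacobiSum (χ ^ i) (χ ^ j)).re ≤
      Fintype.card F - 2 - n + n * (n - 1) * Real.sqrt (Fintype.card F) := by
  set s := Real.sqrt (Fintype.card F)
  have hne : ∀ i < n, χ ^ (i + 1) ≠ 1 := fun i hi ↦
    pow_ne_one_of_lt_orderOf i.succ_ne_zero (by omega)
  have hleft : ∀ i < n, jacobiSum (χ ^ (i + 1)) (χ ^ 0) = -1 := fun i hi ↦ by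
    rw [jacobiSum_comm, pow_zero, jacobiSum_one_nontrivial (hne i hi)]
  have hright : ∀ i < n, jacobiSum (χ ^ 0) (χ ^ (i + 1)) = -1 := fun i hi ↦ by
    rw [pow_zero, jacobiSum_one_nontrivial (hne i hi)]
  have hterm : ∀ i < n, ∀ j < n, (jacobiSum (χ ^ (i + 1)) (χ ^ (j + 1))).re ≤
      s + if j = n - 1 - i then 1 - s else 0 := by
    intro i hi j hj
    refine (Complex.re_le_norm _).trans ?_
    split_ifs with hij
    · have hinv : χ ^ (j + 1) = (χ ^ (i + 1))⁻¹ := by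
        rw [eq_inv_iff_mul_eq_one, ← pow_add, show j + 1 + (i + 1) = n + 1 by omega, ← hχ,
          pow_orderOf_eq_one]
      have hunit : ‖(χ ^ (i + 1)) (-1)‖ = 1 := by
        refine Complex.norm_eq_one_of_pow_eq_one (n := 2) ?_ two_ne_zero
        rw [← map_pow, neg_one_sq, map_one]
      rw [hinv, jacobiSum_nontrivial_inv (hne i hi), norm_neg, hunit]
      linarith
    · rw [norm_jacobiSum_eq_sqrt_card (hne i hi) (hne j hj), add_zero]
      rw [← pow_add]
      intro h
      obtain ⟨c, hc⟩ := hχ ▸ orderOf_dvd_of_pow_eq_one h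
      have hc1 : c = 1 := by
        have hlt : c < 2 := by nlinarith
        have hpos : c ≠ 0 := by rintro rfl; omega
        omega
      subst hc1
      omega
  have hrow : ∀ i ∈ range n, (∑ j ∈ range (n + 1), jacobiSum (χ ^ (i + 1)) (χ ^ j)).re ≤
      (n - 1) * s := by
    intro i hi
    rw [mem_range] at hi
    rw [sum_range_succ', hleft i hi, Complex.add_re, Complex.re_sum]
    have h := sum_le_sum fun j hj ↦ hterm i hi j (mem_range.mp hj)
    rw [sum_add_distrib, sum_ite_eq', if_pos (mem_range.mpr (by omega))] at h
    simp only [sum_const, card_range, nsmul_eq_mul] at h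
    simp only [Complex.neg_re, Complex.one_re]
    linarith
  have hzero : (∑ j ∈ range (n + 1), jacobiSum (χ ^ 0) (χ ^ j)).re =
      Fintype.card F - 2 - n := by
    rw [sum_range_succ', sum_congr rfl fun j hj ↦ hright j (mem_range.mp hj), pow_zero,
      jacobiSum_one_one]
    simp
    ring
  rw [sum_range_succ', Complex.add_re, Complex.re_sum, hzero]
  have h := sum_le_sum hrow
  simp only [sum_const, card_range, nsmul_eq_mul] at h
  linarith

/-- **Theorem (via Weil's bound).** Let `G` be a multiplicative subgroup of the finite field
`F_q`, and suppose that `|G ∩ (1 - G)| ≥ |G| / 2`. Then either `G = F_q^*` or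
`|G| < 2·√q`. -/
theorem near_field_Weil (F : Type*) [Field F] [Fintype F] (G : Subgroup Fˣ)
    (hcard : Nat.card G ≤
      2 * Nat.card {x : F // (∃ g ∈ G, ((g : Fˣ) : F) = x) ∧
        ∃ g ∈ G, ((g : Fˣ) : F) = 1 - x}) :
    G = ⊤ ∨ (Nat.card G : ℝ) < 2 * Real.sqrt (Fintype.card F) := by
  classical
  rcases eq_or_ne G ⊤ with hG | hG
  · exact Or.inl hG
  refine Or.inr ?_
  have hunits : Nat.card G * G.index = Fintype.card F - 1 := by
    rw [G.card_mul_index, Nat.card_eq_fintype_card, Fintype.card_units]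
  have hindex : G.index ≠ 0 := G.index_ne_zero_of_finite
  obtain ⟨χ, hχ⟩ := MulChar.exists_mulChar_orderOf F ⟨_, (mul_comm _ _).trans hunits |>.symm⟩
    (Complex.isPrimitiveRoot_exp G.index hindex)
  obtain ⟨n, hn⟩ := Nat.exists_eq_succ_of_ne_zero hindex
  have hn1 : (1 : ℝ) ≤ n := by
    have : G.index ≠ 1 := fun h ↦ hG (Subgroup.index_eq_one.mp h)
    exact_mod_cast (by omega : 1 ≤ n)
  have hbound := re_sum_jacobiSum_pow_le (hχ.trans hn)
  have hsum := sum_jacobiSum_eq_index_sq_mul_card hχ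
  rw [hn, Nat.succ_eq_add_one] at hsum
  rw [hsum] at hbound
  generalize Nat.card {x : F // (∃ g ∈ G, ((g : Fˣ) : F) = x) ∧
    ∃ g ∈ G, ((g : Fˣ) : F) = 1 - x} = N at hcard hbound
  have hbound' : ((n : ℝ) + 1) ^ 2 * N ≤
      Fintype.card F - 2 - n + n * (n - 1) * Real.sqrt (Fintype.card F) := by
    have hre : (((n + 1 : ℕ) : ℂ) ^ 2 * (N : ℂ)).re = ((n : ℝ) + 1) ^ 2 * N := by
      rw [show ((n + 1 : ℕ) : ℂ) ^ 2 * (N : ℂ) =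
          ((((n : ℝ) + 1) ^ 2 * N : ℝ) : ℂ) by push_cast; rfl,
        Complex.ofReal_re]
    rwa [hre] at hbound
  have hq : (Fintype.card F : ℝ) = Nat.card G * (n + 1) + 1 := by
    have hpos := Fintype.card_pos (α := F)
    rw [hn, Nat.succ_eq_add_one] at hunits
    exact_mod_cast (by omega : Fintype.card F = Nat.card G * (n + 1) + 1)
  have hcard' : (Nat.card G : ℝ) ≤ 2 * N := by exact_mod_cast hcard
  by_contra! hlarge
  have hs := Real.sqrt_nonneg (Fintype.card F)
  generalize Real.sqrt (Fintype.card F) = s at *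
  rw [hq] at hbound'
  generalize (Nat.card G : ℝ) = g at *
  have h₁ := mul_le_mul_of_nonneg_left hcard' (sq_nonneg ((n : ℝ) + 1))
  have h₂ : 0 ≤ ((n : ℝ) + 1) * (n - 1) * (g - 2 * s) :=
    mul_nonneg (mul_nonneg (by linarith) (by linarith)) (by linarith)
  have h₃ : 0 ≤ ((n : ℝ) - 1) * s := mul_nonneg (by linarith) hs
  nlinarith
end

section
/- Let G be a multiplicative subgroup of order k of a finite field F_q of odd characteristic. Suppose that G ∪ {0} is not a subfield of F_q. Then |G ∩ (1 - G)| ≤ (|G| - 1)/2, where 1 - G = {1 - g : g ∈ G}. -/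
open Polynomial in
/-- If `X ^ (k + 1) + (1 - X) ^ (k + 1) - 1` is nonzero, then a finite set `A` of elements `x` other
than `0` and `1` with `x ^ k = (1 - x) ^ k = 1` satisfies `2 * #A + 2 ≤ k + 1`: every element of `A`
is a double root of that polynomial, and `0` and `1` are roots too. -/
theorem two_mul_card_add_two_le_of_pow_eq_one {F : Type*} [Field F] {k : ℕ} (A : Finset F)
    (hP : (X ^ (k + 1) + (1 - X) ^ (k + 1) - 1 : F[X]) ≠ 0)
    (h0 : (0 : F) ∉ A) (h1 : (1 : F) ∉ A)
    (hA : ∀ x ∈ A, x ^ k = 1 ∧ (1 - x) ^ k = 1) :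
    2 * A.card + 2 ≤ k + 1 := by
  classical
  set P : F[X] := X ^ (k + 1) + (1 - X) ^ (k + 1) - 1 with hPdef
  have hdeg : P.natDegree ≤ k + 1 := by
    rw [hPdef]
    compute_degree
  have hroots : 2 • A.val + {0, 1} ≤ P.roots := by
    rw [Multiset.le_iff_count]
    intro a
    rw [count_roots, Multiset.count_add, Multiset.count_nsmul]
    by_cases ha : a ∈ A
    · have ha0 : a ≠ 0 := fun h => h0 (h ▸ ha)
      have ha1 : a ≠ 1 := fun h => h1 (h ▸ ha)
      have hcount : Multiset.count a ({0, 1} : Multiset F) = 0 :=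
        Multiset.count_eq_zero.mpr (by simp [ha0, ha1])
      rw [Multiset.count_eq_one_of_mem A.nodup ha, hcount]
      obtain ⟨hx, hy⟩ := hA a ha
      refine (one_lt_rootMultiplicity_iff_isRoot hP).mpr ⟨?_, ?_⟩
      · simp [hPdef, IsRoot.def, pow_succ, hx, hy]
      · simp [hPdef, IsRoot.def, derivative_pow, hx, hy]
    · rw [Multiset.count_eq_zero.mpr (by simpa using ha)]
      by_cases ha' : a ∈ ({0, 1} : Multiset F)
      · have hnd : ({0, 1} : Multiset F).Nodup := by simp
        rw [Multiset.count_eq_one_of_mem hnd ha']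
        refine (rootMultiplicity_pos hP).mpr ?_
        rcases (by simpa using ha' : a = 0 ∨ a = 1) with rfl | rfl <;> simp [hPdef, IsRoot.def]
      · rw [Multiset.count_eq_zero.mpr ha']
        exact Nat.zero_le _
  have hcard := (Multiset.card_le_card hroots).trans (P.card_roots'.trans hdeg)
  simpa using hcard

/-- A subgroup of order `k` of the units of a finite field consists of all the `k`-th roots of
unity. -/
theorem exists_mem_subgroup_units_iff_pow_card_eq_one {F : Type*} [Field F] [Finite F]
    (G : Subgroup Fˣ) (x : F) :
    (∃ g ∈ G, ((g : Fˣ) : F) = x) ↔ x ^ Nat.card G = 1 := by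
  classical
  have := Fintype.ofFinite G
  let S : Finset F := Finset.univ.image fun g : G => ((g : Fˣ) : F)
  have hinj : Function.Injective fun g : G => ((g : Fˣ) : F) :=
    Units.val_injective.comp Subtype.val_injective
  have hS : S.card = Nat.card G := by
    rw [Finset.card_image_of_injective _ hinj, Finset.card_univ, Nat.card_eq_fintype_card]
  have hpow (g : Fˣ) (hg : g ∈ G) : (g : F) ^ Nat.card G = 1 := by
    have h : g ^ Nat.card G = 1 := congrArg Subtype.val (pow_card_eq_one' (x := (⟨g, hg⟩ : G)))
    rw [← Units.val_pow_eq_pow_val, h, Units.val_one]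
  have hsub : S ⊆ Polynomial.nthRootsFinset (Nat.card G) (1 : F) := by
    intro y hy
    obtain ⟨g, -, rfl⟩ := Finset.mem_image.mp hy
    exact (Polynomial.mem_nthRootsFinset Nat.card_pos 1).mpr (hpow g g.2)
  have heq : S = Polynomial.nthRootsFinset (Nat.card G) (1 : F) := by
    refine Finset.eq_of_subset_of_card_le hsub ?_
    rw [hS, Polynomial.nthRootsFinset_def]
    exact (Multiset.toFinset_card_le _).trans (Polynomial.card_nthRoots _ _)
  constructor
  · rintro ⟨g, hg, rfl⟩
    exact hpow g hg
  · intro hx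
    have hxS : x ∈ S := heq ▸ (Polynomial.mem_nthRootsFinset Nat.card_pos 1).mpr hx
    obtain ⟨g, -, rfl⟩ := Finset.mem_image.mp hxS
    exact ⟨g, g.2, rfl⟩

/-- If `t ^ n + (1 - t) ^ n = 1` for all `t` in a field and `n` is odd, then the solutions of
`x ^ n = x` form a subfield. -/
def subfieldOfPowEqSelf {F : Type*} [Field F] {n : ℕ} (hn : Odd n)
    (h : ∀ t : F, t ^ n + (1 - t) ^ n = 1) : Subfield F where
  carrier := {x | x ^ n = x}
  mul_mem' {x y} (hx : x ^ n = x) (hy : y ^ n = y) := by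
    rw [Set.mem_ofPred_eq, mul_pow, hx, hy]
  one_mem' := one_pow n
  zero_mem' := zero_pow hn.pos.ne'
  add_mem' {x y} (hx : x ^ n = x) (hy : y ^ n = y) := by
    rw [Set.mem_ofPred_eq]
    by_cases hs : x + y = 0
    · rw [hs, zero_pow hn.pos.ne']
    · have ht := h (x / (x + y))
      have hy' : 1 - x / (x + y) = y / (x + y) := by
        field_simp
        ring
      rw [hy', div_pow, div_pow, hx, hy, ← add_div, div_eq_one_iff_eq (pow_ne_zero n hs)] at ht
      exact ht.symm
  neg_mem' {x} (hx : x ^ n = x) := by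
    rw [Set.mem_ofPred_eq, hn.neg_pow, hx]
  inv_mem' x (hx : x ^ n = x) := by
    rw [Set.mem_ofPred_eq, inv_pow, hx]

/-- **Theorem (via García–Voloch's bound).** Let `G` be a multiplicative subgroup of a finite
field `F_q` of odd characteristic. Suppose that `G ∪ {0}` is not a subfield of `F_q`. Then
`|G ∩ (1 - G)| ≤ (|G| - 1)/2`. -/
theorem near_field_Garcia_Voloch (F : Type*) [Field F] [Fintype F]
    (hodd : Odd (ringChar F)) (G : Subgroup Fˣ)
    (hns : ¬ ∃ K : Subfield F,
      (K : Set F) = {x : F | x = 0 ∨ ∃ g ∈ G, ((g : Fˣ) : F) = x}) :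
    Nat.card {x : F // (∃ g ∈ G, ((g : Fˣ) : F) = x) ∧
      ∃ g ∈ G, ((g : Fˣ) : F) = 1 - x} ≤ (Nat.card G - 1) / 2 := by
  classical
  have htwo : (2 : F) ≠ 0 := Ring.two_ne_zero fun h => absurd (h ▸ hodd) (by decide)
  have hk : 0 < Nat.card G := Nat.card_pos
  simp only [exists_mem_subgroup_units_iff_pow_card_eq_one] at hns ⊢
  set k := Nat.card G
  have hP : (Polynomial.X ^ (k + 1) + (1 - Polynomial.X) ^ (k + 1) - 1 : Polynomial F) ≠ 0 := by
    intro hzero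
    have heval (t : F) : t ^ (k + 1) + (1 - t) ^ (k + 1) = 1 := by
      simpa [sub_eq_zero] using congrArg (Polynomial.eval t) hzero
    rcases Nat.even_or_odd (k + 1) with hn | hn
    · have h := heval (-1)
      rw [hn.neg_pow, one_pow, sub_neg_eq_add, one_add_one_eq_two, add_eq_left] at h
      exact pow_ne_zero _ htwo h
    · refine hns ⟨subfieldOfPowEqSelf hn heval, Set.ext fun x => ?_⟩
      change x ^ (k + 1) = x ↔ x = 0 ∨ x ^ k = 1
      rw [pow_succ, mul_left_eq_self₀, or_comm]
  have hbound := two_mul_card_add_two_le_of_pow_eq_one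
    (Finset.univ.filter fun x : F => x ^ k = 1 ∧ (1 - x) ^ k = 1) hP
    (by simp [hk.ne']) (by simp [hk.ne']) (by simp)
  rw [Nat.card_eq_fintype_card, Fintype.card_subtype]
  omega
end

section
/- Let p be an odd prime, and let h, k be positive integers with h odd and p ∤ h. Suppose that k ≥ 5, and that either 3h < 2k + 5, or p = 3 and 5h < 4k + 9. Suppose that the binomial coefficient C(k,i) viewed modulo p is a periodic function of i with period h in the range 0 ≤ i ≤ k, i.e. C(k, i+h) ≡ C(k,i) (mod p) for all integers i with 0 ≤ i ≤ k - h. Then k + 1 is twice a power of p, or p = 3 and k + 1 is four times a power of 3, or (p, k, h) = (3, 7, 7). -/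
/-- If `C(k, i)` has period `h` modulo `p`, with `p ∤ h`, then consecutive coefficients are opposite
modulo `p` as long as they can be shifted by `h`. -/
theorem choose_succ_add_choose_eq_zero_of_periodic {p h k : ℕ} [Fact p.Prime] (hph : ¬ p ∣ h)
    (hper : ∀ i : ℕ, i + h ≤ k → (k.choose (i + h) : ZMod p) = k.choose i)
    {i : ℕ} (hi : i + 1 + h ≤ k) : (k.choose (i + 1) : ZMod p) + k.choose i = 0 := by
  have hstep (j : ℕ) (hj : j + 1 ≤ k) :
      (k.choose (j + 1) : ZMod p) * (j + 1) = k.choose j * (k - j) := by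
    have := congrArg (Nat.cast : ℕ → ZMod p) (Nat.choose_succ_right_eq k j)
    push_cast [Nat.cast_sub (show j ≤ k by lia)] at this
    exact this
  have hlow := hstep i (by lia)
  have hhigh := hstep (i + h) (by lia)
  rw [show i + h + 1 = i + 1 + h by ring, hper _ hi, hper i (by lia)] at hhigh
  push_cast at hhigh
  have hh : (h : ZMod p) ≠ 0 := by rwa [Ne, ZMod.natCast_eq_zero_iff]
  refine (mul_eq_zero.mp ?_).resolve_left hh
  linear_combination hhigh - hlow

theorem choose_prime_sub_one_eq_neg_one_pow {p t : ℕ} [Fact p.Prime] (ht : t < p) :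
    ((p - 1).choose t : ZMod p) = (-1) ^ t := by
  induction t with
  | zero => simp
  | succ t ih =>
    have hp : p.Prime := Fact.out
    have hsucc : (p.choose (t + 1) : ZMod p) = 0 := by
      rw [ZMod.natCast_eq_zero_iff]
      exact hp.dvd_choose_self (by lia) ht
    rw [Nat.choose_eq_choose_pred_add hp.pos t.succ_pos] at hsucc
    rw [Nat.succ_sub_one, Nat.cast_add, ih (by lia)] at hsucc
    rw [pow_succ]
    linear_combination hsucc

/-- Lucas' congruence for an upper index whose `s` lowest base-`p` digits are all `p - 1`. -/
theorem choose_mul_pow_add_pow_sub_one {p : ℕ} [Fact p.Prime] (hpodd : Odd p) (s m a r : ℕ)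
    (hr : r < p ^ s) :
    ((m * p ^ s + (p ^ s - 1)).choose (a * p ^ s + r) : ZMod p) = m.choose a * (-1) ^ r := by
  have hp : p.Prime := Fact.out
  induction s generalizing r with
  | zero =>
    obtain rfl : r = 0 := by simpa using hr
    simp
  | succ s ih =>
    have hq : 0 < p ^ s := pow_pos hp.pos s
    have ht : r % p < p := Nat.mod_lt _ hp.pos
    have hdiv : p * (r / p) + r % p = r := Nat.div_add_mod r p
    have hupper : m * p ^ (s + 1) + (p ^ (s + 1) - 1) = (p - 1) + p * (m * p ^ s + (p ^ s - 1)) := by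
      have hpos := pow_pos hp.pos (s + 1)
      have hone := hp.one_le
      zify [hpos, hone, hq]
      ring
    have hlower : a * p ^ (s + 1) + r = r % p + p * (a * p ^ s + r / p) := by
      rw [pow_succ]
      linear_combination -hdiv
    have hlucas := (ZMod.natCast_eq_natCast_iff _ _ p).mpr
      (Choose.choose_modEq_choose_mod_mul_choose_div_nat (p := p)
        (n := m * p ^ (s + 1) + (p ^ (s + 1) - 1)) (k := a * p ^ (s + 1) + r))
    rw [hlucas, hupper, hlower, Nat.add_mul_mod_self_left, Nat.add_mul_mod_self_left,
      Nat.add_mul_div_left _ _ hp.pos, Nat.add_mul_div_left _ _ hp.pos,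
      Nat.mod_eq_of_lt ht, Nat.mod_eq_of_lt (Nat.sub_lt hp.pos one_pos), Nat.div_eq_of_lt ht,
      Nat.div_eq_of_lt (Nat.sub_lt hp.pos one_pos), zero_add, zero_add, Nat.cast_mul,
      ih (r / p) (Nat.div_lt_of_lt_mul (by rwa [pow_succ'] at hr)),
      choose_prime_sub_one_eq_neg_one_pow ht]
    conv_rhs => rw [← hdiv, pow_add, pow_mul, hpodd.neg_one_pow]
    ring

/-- **Theorem (unsigned analogue).** Let `p` be an odd prime, and let `h, k` be positive
integers with `h` odd and `p ∤ h`. Suppose that `k ≥ 5`, and that either `3h < 2k + 5`, or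
`p = 3` and `5h < 4k + 9`. Suppose that `C(k,i) (mod p)` is a periodic function of `i` with
period `h` in the range `0 ≤ i ≤ k`. Then `k + 1` is twice a power of `p`, or `p = 3` and
`k + 1` is four times a power of `3`, or `(p, k, h) = (3, 7, 7)`. -/
theorem modular_periodicity_unsigned (p h k : ℕ) (hp : p.Prime) (hpodd : Odd p)
    (hh : 0 < h) (hhodd : Odd h) (hph : ¬ p ∣ h) (hk : 5 ≤ k)
    (hineq : 3 * h < 2 * k + 5 ∨ (p = 3 ∧ 5 * h < 4 * k + 9))
    (hper : ∀ i : ℕ, i + h ≤ k → (k.choose (i + h) ≡ k.choose i [MOD p])) :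
    (∃ r : ℕ, k + 1 = 2 * p ^ r) ∨ (p = 3 ∧ ∃ r : ℕ, k + 1 = 4 * 3 ^ r) ∨
      (p = 3 ∧ k = 7 ∧ h = 7) := by
  have : Fact p.Prime := ⟨hp⟩
  have hperiod (i : ℕ) (hi : i + h ≤ k) : (k.choose (i + h) : ZMod p) = k.choose i :=
    (ZMod.natCast_eq_natCast_iff _ _ p).mpr (hper i hi)
  obtain ⟨s, m, hpm, hkm⟩ := Nat.exists_eq_pow_mul_and_not_dvd (Nat.succ_ne_zero k) p hp.ne_one
  obtain ⟨n, rfl⟩ : ∃ n, m = n + 1 := Nat.exists_eq_succ_of_ne_zero (by rintro rfl; simp at hpm)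
  have hlucas := choose_mul_pow_add_pow_sub_one hpodd s n
  have hqodd : Odd (p ^ s) := hpodd.pow
  generalize hq : p ^ s = q at *
  have hqpos : 0 < q := hqodd.pos
  have hk_eq : n * q + (q - 1) = k := by
    have : q * (n + 1) = n * q + q := by ring
    lia
  rw [hk_eq] at hlucas
  have hone_ne : (1 : ZMod p) ≠ -1 := by
    have : Fact (2 < p) := ⟨by have := hp.two_le; rcases hpodd with ⟨c, hc⟩; lia⟩
    exact (ZMod.neg_one_ne_one).symm
  have hlarge : k < q + h := by
    by_contra! hle
    have hzero := choose_succ_add_choose_eq_zero_of_periodic hph hperiod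
      (i := q - 1) (by lia)
    rw [show q - 1 + 1 = 1 * q + 0 by lia, hlucas 1 0 hqpos,
      show q - 1 = 0 * q + (q - 1) by lia, hlucas 0 _ (by lia),
      (hqodd.tsub_odd odd_one).neg_one_pow] at hzero
    apply hpm
    rw [← ZMod.natCast_eq_zero_iff]
    push_cast
    simpa using hzero
  have hlower : n * q ≤ h := by lia
  have hn : n ≠ 0 := by
    rintro rfl
    have hsign := hlucas 0 h (by lia)
    have hfirst := hperiod 0 (by lia)
    rw [zero_add, Nat.choose_zero_right, Nat.cast_one] at hfirst
    rw [zero_mul, zero_add, hfirst, hhodd.neg_one_pow] at hsign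
    exact hone_ne (by simpa using hsign)
  have hn_le : n ≤ 8 := by
    by_contra! hgt
    have : 9 * q ≤ n * q := Nat.mul_le_mul_right q hgt
    lia
  obtain ⟨c, rfl⟩ := hqodd
  obtain ⟨d, rfl⟩ := hhodd
  rcases eq_or_ne n 1 with rfl | hn1
  · exact Or.inl ⟨s, by lia⟩
  by_cases hfour : p = 3 ∧ n = 3
  · obtain ⟨rfl, rfl⟩ := hfour
    exact Or.inr (Or.inl ⟨rfl, s, by lia⟩)
  refine Or.inr (Or.inr ?_)
  rcases hineq with hlt | ⟨rfl, hlt⟩ <;> interval_cases n <;> lia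
end

section
/- Let p be a prime, and let h, k be positive integers with p ∤ h and 2h ≤ k. Suppose that the binomial coefficient C(k,i) viewed modulo p is a periodic function of i with period h in the range 0 ≤ i ≤ k, i.e. C(k, i+h) ≡ C(k,i) (mod p) for all integers i with 0 ≤ i ≤ k - h. Then k + 1 is a power of p. -/
open Polynomial in
/-- If a high power of `1 + X` divides `X ^ (k + 1) * B - A` for polynomials `A`, `B` of small
degree, then `A` and `X ^ (k + 1) * B - A` have the same logarithmic derivative. -/
theorem mul_derivative_eq_of_X_pow_mul_sub_eq {K : Type*} [Field K] {A B g : K[X]} {k m : ℕ}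
    (hA : A.natDegree ≤ m) (hB : B.natDegree ≤ m) (hk : 2 * m + 2 ≤ k)
    (hf : X ^ (k + 1) * B - A = g * (1 + X) ^ k) :
    A * derivative (g * (1 + X) ^ k) = derivative A * (g * (1 + X) ^ k) := by
  obtain ⟨n, rfl⟩ : ∃ n, k = n + 1 := ⟨k - 1, by omega⟩
  have X_mul_derivative_natDegree_le : ∀ P : K[X], P.natDegree ≤ m →
      (X * derivative P).natDegree ≤ m := by
    intro P hP
    refine natDegree_le_iff_coeff_eq_zero.2 fun N hN => ?_
    obtain ⟨N, rfl⟩ : ∃ M, N = M + 1 := ⟨N - 1, by omega⟩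
    rw [coeff_X_mul, coeff_derivative, coeff_eq_zero_of_natDegree_lt (by omega), zero_mul]
  set W : K[X] := C ((n + 1 + 1 : ℕ) : K) * (A * B) + (X * derivative B) * A
    - B * (X * derivative A) with hW
  have key : A * derivative (g * (1 + X) ^ (n + 1)) - derivative A * (g * (1 + X) ^ (n + 1))
      = X ^ (n + 1) * W := by
    rw [← hf, hW, derivative_sub, derivative_mul, derivative_X_pow]
    simp only [Nat.add_sub_cancel]
    ring
  have hdvd : (1 + X : K[X]) ^ n ∣ X ^ (n + 1) * W := by
    rw [← key, derivative_mul, derivative_pow]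
    refine ⟨A * (derivative g * (1 + X) + g * (C ((n + 1 : ℕ) : K) * derivative (1 + X)))
      - derivative A * (g * (1 + X)), ?_⟩
    simp only [Nat.add_sub_cancel]
    ring
  have hcop : IsCoprime ((1 + X : K[X]) ^ n) (X ^ (n + 1)) :=
    IsCoprime.pow ⟨1, -1, by ring⟩
  have hWdeg : W.natDegree ≤ m + m := by
    refine (natDegree_sub_le _ _).trans (max_le (natDegree_add_le_of_degree_le ?_ ?_) ?_)
    · exact (natDegree_C_mul_le _ _).trans (natDegree_mul_le_of_le hA hB)
    · exact natDegree_mul_le_of_le (X_mul_derivative_natDegree_le B hB) hA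
    · exact natDegree_mul_le_of_le hB (X_mul_derivative_natDegree_le A hA)
  have hudeg : ((1 + X : K[X]) ^ n).natDegree = n := by
    rw [natDegree_pow, add_comm, ← C_1, natDegree_X_add_C, mul_one]
  have hW0 : W = 0 :=
    eq_zero_of_dvd_of_natDegree_lt (hcop.dvd_of_dvd_mul_left hdvd) (by omega)
  rwa [hW0, mul_zero, sub_eq_zero] at key

open Polynomial in
/-- A polynomial of degree less than `h` and constant term `1` which has the same logarithmic
derivative as `(X ^ h - 1) * (1 + X) ^ k` equals `(1 - X ^ h) / (1 + X)`. -/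
theorem mul_one_add_X_eq_one_sub_X_pow {K : Type*} [Field K] {A : K[X]} {h k : ℕ}
    (hA : A.natDegree < h) (hA0 : A.coeff 0 = 1) (hhK : (h : K) ≠ 0)
    (hder : A * derivative ((X ^ h - 1) * (1 + X) ^ k)
      = derivative A * ((X ^ h - 1) * (1 + X) ^ k)) :
    A * (1 + X) = 1 - X ^ h := by
  obtain ⟨n, rfl⟩ : ∃ n, h = n + 1 := ⟨h - 1, by omega⟩
  have hu : (1 + X : K[X]) ≠ 0 := by
    rw [add_comm, ← C_1]; exact X_add_C_ne_zero _
  have hlog : A * (C ((n + 1 : ℕ) : K) * X ^ n * (1 + X) + (X ^ (n + 1) - 1) * C (k : K))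
      = derivative A * ((X ^ (n + 1) - 1) * (1 + X)) := by
    refine mul_right_cancel₀ (pow_ne_zero k hu) ?_
    have hpow : derivative ((1 + X : K[X]) ^ k) * (1 + X) = C (k : K) * (1 + X) ^ k := by
      rcases k with _ | k
      · simp
      · simp [derivative_pow]; ring
    have hX : derivative (X ^ (n + 1) - 1 : K[X]) = C ((n + 1 : ℕ) : K) * X ^ n := by
      rw [derivative_sub, derivative_X_pow, derivative_one, sub_zero, Nat.add_sub_cancel]
    rw [derivative_mul, hX] at hder
    linear_combination (1 + X) * hder - A * (X ^ (n + 1) - 1) * hpow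
  have hdvd : (X ^ (n + 1) - 1 : K[X]) ∣ C ((n + 1 : ℕ) : K) * X ^ n * (A * (1 + X)) :=
    ⟨derivative A * (1 + X) - A * C (k : K), by linear_combination hlog⟩
  have hcop : IsCoprime (X ^ (n + 1) - 1 : K[X]) (C ((n + 1 : ℕ) : K) * X ^ n) := by
    refine ⟨-1, C ((n + 1 : ℕ) : K)⁻¹ * X, ?_⟩
    have hC : C ((n + 1 : ℕ) : K)⁻¹ * C ((n + 1 : ℕ) : K) = 1 := by
      rw [← C_mul, inv_mul_cancel₀ hhK, C_1]
    linear_combination X ^ (n + 1) * hC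
  obtain ⟨c, hc⟩ := hcop.dvd_of_dvd_mul_left hdvd
  have hA1 : A ≠ 0 := by rintro rfl; simp at hA0
  have hc0 : c ≠ 0 := by
    rintro rfl
    exact mul_ne_zero hA1 hu (by simpa using hc)
  have hXne : (X ^ (n + 1) - 1 : K[X]) ≠ 0 := by
    rw [← C_1]; exact X_pow_sub_C_ne_zero n.succ_pos _
  have hcdeg : c.natDegree = 0 := by
    have hdeg := congrArg natDegree hc
    have hudeg : (1 + X : K[X]).natDegree = 1 := by
      rw [add_comm, ← C_1, natDegree_X_add_C]
    have hXdeg : (X ^ (n + 1) - 1 : K[X]).natDegree = n + 1 := by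
      rw [← C_1, natDegree_X_pow_sub_C]
    rw [natDegree_mul hA1 hu, natDegree_mul hXne hc0, hudeg, hXdeg] at hdeg
    omega
  rw [eq_C_of_natDegree_eq_zero hcdeg] at hc
  have hconst := congrArg (fun P : K[X] => P.coeff 0) hc
  simp only [mul_coeff_zero, hA0] at hconst
  have hc1 : c.coeff 0 = -1 := by
    simp at hconst
    rw [hconst, neg_neg]
  rw [hc, hc1, C_neg, C_1]
  ring

open Polynomial in
/-- Over a field of characteristic `p`, if `(1 + X) ^ n = 1 + X ^ n` with `n` positive, then `n`
is a power of `p`. -/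
theorem exists_eq_pow_of_one_add_X_pow_eq {K : Type*} [Field K] {p n : ℕ} [Fact p.Prime]
    [CharP K p] (hn : n ≠ 0) (H : (1 + X : K[X]) ^ n = 1 + X ^ n) : ∃ r : ℕ, n = p ^ r := by
  have hp : p.Prime := Fact.out
  obtain ⟨a, m, hm, rfl⟩ := Nat.exists_eq_pow_mul_and_not_dvd hn p hp.ne_one
  have hexp : (1 + X : K[X]) ^ m = 1 + X ^ m := by
    refine expand_injective (pow_pos hp.pos a) ?_
    rw [pow_mul, add_pow_char_pow, one_pow] at H
    simpa [pow_mul] using H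
  refine ⟨a, ?_⟩
  by_contra hne
  have hm1 : m ≠ 1 := by rintro rfl; simp at hne
  have hcoeff := congrArg (fun P : K[X] => P.coeff 1) hexp
  simp only [coeff_one_add_X_pow, coeff_add, coeff_X_pow, coeff_one, Nat.choose_one_right] at hcoeff
  rw [if_neg one_ne_zero, if_neg hm1.symm, add_zero, CharP.cast_eq_zero_iff K p] at hcoeff
  exact hm hcoeff

open Polynomial in
/-- **Corollary (unsigned).** Let `p` be a prime, and let `h, k` be positive integers with
`p ∤ h` and `2h ≤ k`. Suppose that `C(k,i)` viewed modulo `p` is a periodic function of `i`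
with period `h` in the range `0 ≤ i ≤ k`. Then `k + 1` is a power of `p`. -/
theorem modular_periodicity_unsigned_weaker (p h k : ℕ) (hp : p.Prime) (hh : 0 < h)
    (hk : 0 < k) (hph : ¬ p ∣ h) (h2h : 2 * h ≤ k)
    (hper : ∀ i : ℕ, i + h ≤ k → (k.choose (i + h) ≡ k.choose i [MOD p])) :
    ∃ r : ℕ, k + 1 = p ^ r := by
  have : Fact p.Prime := ⟨hp⟩
  let A : (ZMod p)[X] := ∑ i ∈ Finset.range h, C (k.choose i : ZMod p) * X ^ i
  have hAcoeff : ∀ d, A.coeff d = if d < h then (k.choose d : ZMod p) else 0 := by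
    intro d
    simp [A, finsetSum_coeff, coeff_X_pow]
  have hAdeg : A.natDegree ≤ h - 1 := by
    refine natDegree_le_iff_coeff_eq_zero.2 fun N hN => ?_
    rw [hAcoeff, if_neg (by omega)]
  have hA0 : A.coeff 0 = 1 := by simp [hAcoeff, hh]
  obtain ⟨B, hB⟩ : (X : (ZMod p)[X]) ^ (k + 1) ∣ (X ^ h - 1) * (1 + X) ^ k + A := by
    refine X_pow_dvd_iff.2 fun d hd => ?_
    rw [coeff_add, sub_mul, one_mul, coeff_sub, coeff_X_pow_mul', hAcoeff,
      coeff_one_add_X_pow, coeff_one_add_X_pow]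
    by_cases hdh : h ≤ d
    · have hcongr := (ZMod.natCast_eq_natCast_iff _ _ _).2 (hper (d - h) (by omega))
      rw [Nat.sub_add_cancel hdh] at hcongr
      rw [if_pos hdh, if_neg (by omega), hcongr, sub_self, add_zero]
    · rw [if_neg hdh, if_pos (by omega), zero_sub, neg_add_cancel]
  have hBdeg : B.natDegree ≤ h - 1 := by
    rcases eq_or_ne B 0 with rfl | hB0
    · simp
    have hle : ((X ^ h - 1) * (1 + X) ^ k + A : (ZMod p)[X]).natDegree ≤ h + k := by
      refine natDegree_add_le_of_degree_le (natDegree_mul_le_of_le ?_ ?_) (by omega)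
      · rw [← C_1, natDegree_X_pow_sub_C]
      · rw [natDegree_pow, add_comm, ← C_1, natDegree_X_add_C, mul_one]
    rw [hB, natDegree_mul (pow_ne_zero _ X_ne_zero) hB0, natDegree_X_pow] at hle
    omega
  have hder := mul_derivative_eq_of_X_pow_mul_sub_eq hAdeg hBdeg (by omega)
    (show X ^ (k + 1) * B - A = (X ^ h - 1) * (1 + X) ^ k by rw [← hB, add_sub_cancel_right])
  have hAu := mul_one_add_X_eq_one_sub_X_pow (by omega) hA0
    (by rwa [Ne, CharP.cast_eq_zero_iff (ZMod p) p]) hder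
  have hcop : IsCoprime ((X : (ZMod p)[X]) ^ (k + 1)) A := by
    refine IsCoprime.pow_left ((irreducible_X.coprime_iff_not_dvd).2 fun hdvd => ?_)
    rw [X_dvd_iff, hA0] at hdvd
    exact one_ne_zero hdvd
  have hXdvd : (X : (ZMod p)[X]) ^ (k + 1) ∣ (1 + X) ^ (k + 1) - 1 := by
    refine hcop.dvd_of_dvd_mul_left ⟨-B, ?_⟩
    linear_combination (1 + X) ^ k * hAu - hB
  refine exists_eq_pow_of_one_add_X_pow_eq (K := ZMod p) k.succ_ne_zero ?_
  ext d
  rw [X_pow_dvd_iff] at hXdvd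
  rcases lt_trichotomy d (k + 1) with hd | rfl | hd
  · rw [coeff_add, coeff_X_pow, if_neg hd.ne, add_zero, ← sub_eq_zero, ← coeff_sub]
    exact hXdvd d hd
  · simp [coeff_one_add_X_pow, coeff_one]
  · rw [coeff_one_add_X_pow, Nat.choose_eq_zero_of_lt hd, coeff_add, coeff_X_pow, coeff_one,
      if_neg hd.ne', if_neg (by omega), Nat.cast_zero, add_zero]
end

section
/- Let G be a multiplicative subgroup of a finite field F_q which generates F_q as a field, and let H be a proper subgroup of G. Suppose that α + 1 ∈ G for all α ∈ G \ H. Then G is the whole multiplicative group F_q^* of nonzero elements of F_q. -/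
/-- Elements of a subgroup of the unit group are roots of unity of the subgroup's order. -/
theorem Subgroup.val_pow_card_eq_one {M : Type*} [Monoid M] (K : Subgroup Mˣ) {a : Mˣ}
    (ha : a ∈ K) : (a : M) ^ Nat.card K = 1 := by
  have hpow : (⟨a, ha⟩ : K) ^ Nat.card K = 1 := pow_card_eq_one'
  have hpow' : a ^ Nat.card K = 1 := congrArg Subtype.val hpow
  rw [← Units.val_pow_eq_pow_val, hpow', Units.val_one]

open Polynomial in
/-- If every `a ∈ G \ H` satisfies `a + 1 ∈ G`, then `X ^ |G| - 1` divides
`(X ^ |H| - 1) * ((X + 1) ^ |G| - 1)`, with a cofactor of degree at most `|H|`. -/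
theorem exists_cofactor_of_add_one_mem {F : Type*} [Field F] [Fintype F] (G H : Subgroup Fˣ)
    (hyp : ∀ α : Fˣ, α ∈ G → α ∉ H → ∃ β ∈ G, (β : F) = (α : F) + 1) :
    ∃ g : F[X], g.natDegree ≤ Nat.card H ∧
      (X ^ Nat.card H - 1) * ((X + 1) ^ Nat.card G - 1) = (X ^ Nat.card G - 1) * g := by
  classical
  set n := Nat.card G with hn
  set h := Nat.card H
  have hn0 : n ≠ 0 := Nat.card_pos.ne'
  set Q : F[X] := (X ^ h - 1) * ((X + 1) ^ n - 1) with hQ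
  have hmonic : (X ^ n - 1 : F[X]).Monic := by
    simpa using monic_X_pow_sub_C (1 : F) hn0
  have hdeg : (X ^ n - 1 : F[X]).natDegree = n := by
    simpa using natDegree_X_pow_sub_C (n := n) (r := (1 : F))
  have hdiv : Q %ₘ (X ^ n - 1) + (X ^ n - 1) * (Q /ₘ (X ^ n - 1)) = Q :=
    modByMonic_add_div Q _
  have hrem : Q %ₘ (X ^ n - 1) = 0 := by
    refine eq_zero_of_natDegree_lt_card_of_eval_eq_zero (Q %ₘ (X ^ n - 1))
      (f := fun a : G => ((a : Fˣ) : F))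
      (fun a b hab => Subtype.ext (Units.ext hab)) (fun a => ?_) ?_
    · have heval := congrArg (eval ((a : Fˣ) : F)) hdiv
      have hQa : eval ((a : Fˣ) : F) Q = 0 := by
        by_cases haH : (a : Fˣ) ∈ H
        · have hHa : ((a : Fˣ) : F) ^ h = 1 := H.val_pow_card_eq_one haH
          simp [hQ, hHa]
        · obtain ⟨β, hβ, e⟩ := hyp a a.2 haH
          have hGβ : (β : F) ^ n = 1 := G.val_pow_card_eq_one hβ
          simp [hQ, ← e, hGβ]
      have hGa : ((a : Fˣ) : F) ^ n = 1 := G.val_pow_card_eq_one a.2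
      simp only [eval_add, eval_mul, eval_sub, eval_pow, eval_X, eval_one, hQa] at heval
      simpa [hGa] using heval
    · rw [← Nat.card_eq_fintype_card, ← hn]
      have hne : (X ^ n - 1 : F[X]) ≠ 1 := by
        intro h1
        rw [h1, natDegree_one] at hdeg
        exact hn0 hdeg.symm
      simpa [hdeg] using natDegree_modByMonic_lt Q hmonic hne
  refine ⟨Q /ₘ (X ^ n - 1), ?_, ?_⟩
  · rw [natDegree_divByMonic Q hmonic, hdeg]
    have hQdeg : Q.natDegree ≤ h + n := by
      rw [hQ]
      compute_degree
    omega
  · rw [hrem, zero_add] at hdiv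
    exact hdiv.symm

open Polynomial in
/-- The binomial coefficients of `|G|` are periodic in `F` with period `|H|`. -/
theorem choose_periodic_of_add_one_mem {F : Type*} [Field F] [Fintype F] (G H : Subgroup Fˣ)
    (hlt : Nat.card H < Nat.card G)
    (hyp : ∀ α : Fˣ, α ∈ G → α ∉ H → ∃ β ∈ G, (β : F) = (α : F) + 1) (j : ℕ)
    (hj : j + Nat.card H ≤ Nat.card G) :
    ((Nat.card G).choose (j + Nat.card H) : F) = (Nat.card G).choose j := by
  obtain ⟨g, hg, e⟩ := exists_cofactor_of_add_one_mem G H hyp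
  have h0 : 0 < Nat.card H := Nat.card_pos
  generalize Nat.card G = n at *
  generalize Nat.card H = h at *
  have hcoeff (t : ℕ) := congrArg (fun P : F[X] => P.coeff t) e
  simp only [sub_mul, one_mul, coeff_sub, coeff_X_pow_mul', coeff_X_add_one_pow,
    coeff_one] at hcoeff
  have hbase : (n.choose h : F) = 1 := by
    have e₁ := hcoeff h
    have e₂ := hcoeff (h + n)
    have hgn : g.coeff (h + n) = 0 := coeff_eq_zero_of_natDegree_lt (by omega)
    simp [h0.ne', hlt.not_ge, Nat.choose_eq_zero_of_lt (show n < h + n by omega), hgn,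
      (show n ≠ 0 by omega)] at e₁ e₂
    rw [← e₂] at e₁
    exact e₁
  rcases Nat.eq_zero_or_pos j with rfl | hj0
  · simpa using hbase
  rcases hj.lt_or_eq with hj' | hj'
  · have e₁ := hcoeff (j + h)
    have hgn : g.coeff (j + h) = 0 := coeff_eq_zero_of_natDegree_lt (by omega)
    simp [h0.ne', hj0.ne', hj'.not_ge, hgn] at e₁
    linear_combination -e₁
  · rw [hj', Nat.choose_self, Nat.cast_one, ← hbase, Nat.choose_symm_of_eq_add hj'.symm]

/-- If the binomial coefficients of `n` are periodic modulo `p`, with a period `h ≤ n / 2` prime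
to `p`, then `n + 1` is a power of `p`. -/
theorem exists_add_one_eq_pow_of_choose_periodic {F : Type*} [Field F] {p : ℕ} [CharP F p]
    (hp : p.Prime) {n h : ℕ} (h0 : 0 < h) (hn : 2 * h ≤ n) (hph : ¬ p ∣ h)
    (hper : ∀ j, j + h ≤ n → (n.choose (j + h) : F) = n.choose j) :
    ∃ e, n + 1 = p ^ e := by
  have hbase : (n.choose h : F) = 1 := by simpa using hper 0 (by omega)
  have hpn : p ∣ n + 1 := by
    have e₁ : ((n.choose (h + 1) * (h + 1) : ℕ) : F) = (n.choose h * (n - h) : ℕ) :=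
      congrArg _ (Nat.choose_succ_right_eq n h)
    have e₂ := hper 1 (by omega)
    rw [add_comm 1 h, Nat.choose_one_right] at e₂
    push_cast [Nat.cast_sub (show h ≤ n by omega)] at e₁
    rw [e₂, hbase] at e₁
    have e₃ : ((h * (n + 1) : ℕ) : F) = 0 := by
      push_cast
      linear_combination e₁
    exact (hp.dvd_mul.1 ((CharP.cast_eq_zero_iff F p _).1 e₃)).resolve_left hph
  obtain ⟨e, M, hM, hnM⟩ := Nat.exists_eq_pow_mul_and_not_dvd (Nat.succ_ne_zero n) p hp.ne_one
  rw [Nat.succ_eq_add_one] at hnM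
  have he : e ≠ 0 := by
    rintro rfl
    rw [pow_zero, one_mul] at hnM
    exact hM (hnM ▸ hpn)
  have hpP : p ∣ p ^ e := dvd_pow_self p he
  have hPpos : 0 < p ^ e := pow_pos hp.pos e
  -- Modulo `p`, the coefficient `(n + 1).choose j` vanishes unless `p ^ e ∣ j`.
  have hvanish (j : ℕ) (hj : ¬ p ^ e ∣ j + 1) :
      (n.choose j : F) + n.choose (j + 1) = 0 := by
    have e₁ := Nat.add_one_mul_choose_eq n j
    have hd : p ∣ (n + 1).choose (j + 1) := by
      by_contra hnd
      have hco : Nat.Coprime (p ^ e) ((n + 1).choose (j + 1)) :=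
        ((Nat.Prime.coprime_iff_not_dvd hp).2 hnd).pow_left e
      refine hj (hco.dvd_of_dvd_mul_left ?_)
      rw [← e₁, hnM, mul_assoc]
      exact dvd_mul_right _ _
    have := (CharP.cast_eq_zero_iff F p _).2 hd
    rw [Nat.choose_succ_succ] at this
    exact_mod_cast this
  refine ⟨e, ?_⟩
  by_contra hne
  generalize hP : p ^ e = P at *
  set i := h / P with hi
  have hdm : P * i + h % P = h := Nat.div_add_mod h P
  have hmod : h % P < P := Nat.mod_lt h hPpos
  have hM2 : 2 ≤ M := by
    by_contra hlt
    have : M = 0 ∨ M = 1 := by omega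
    rcases this with rfl | rfl
    · exact hM (dvd_zero p)
    · exact hne (by simpa using hnM)
  have hiM : i + 1 < M := by
    have : P * (2 * i) < P * M := by
      rw [← hnM, show P * (2 * i) = 2 * (P * i) by ring]
      omega
    have := Nat.lt_of_mul_lt_mul_left this
    omega
  have hle : P * (i + 2) ≤ P * M := Nat.mul_le_mul_left P hiM
  have hs2 : P * (i + 2) = P * i + P + P := by ring
  have hs1 : P * (i + 1) = P * i + P := by ring
  have hP1 : 1 < P := hP ▸ Nat.one_lt_pow he hp.one_lt
  have hnonzero (t : ℕ) (ht : h + t < P * (i + 1)) : (n.choose (h + t) : F) ≠ 0 := by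
    induction t with
    | zero => simp [hbase]
    | succ t ih =>
      have hnd : ¬ P ∣ h + t + 1 := by
        rintro ⟨c, hc⟩
        have h₁ : P * i < P * c := by omega
        have h₂ : P * c < P * (i + 1) := by omega
        have := Nat.lt_of_mul_lt_mul_left h₁
        have := Nat.lt_of_mul_lt_mul_left h₂
        omega
      intro h0'
      have := hvanish (h + t) hnd
      rw [add_assoc, h0', add_zero] at this
      exact ih (by omega) this
  obtain ⟨u, hu⟩ : ∃ u, P * (i + 1) = u + 1 + h := ⟨P * (i + 1) - h - 1, by omega⟩
  have hnu : ¬ P ∣ u + 1 := by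
    intro hd
    have : P ∣ h := (Nat.dvd_add_right hd).1 (hu ▸ dvd_mul_right P (i + 1))
    exact hph (hpP.trans this)
  have hsum := hvanish u hnu
  rw [← hper u (by omega), ← hper (u + 1) (by omega),
    show u + 1 + h = u + h + 1 by omega, ← Nat.cast_add, ← Nat.choose_succ_succ] at hsum
  have e₁ := Nat.add_one_mul_choose_eq n (u + h)
  rw [show u + h + 1 = P * (i + 1) by omega, hnM] at e₁
  have e₂ : M * n.choose (u + h) = (P * M).choose (P * (i + 1)) * (i + 1) := by
    apply Nat.eq_of_mul_eq_mul_left hPpos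
    linear_combination e₁
  have e₃ : ((M * n.choose (u + h) : ℕ) : F) = 0 := by
    rw [e₂, Nat.cast_mul, ← hnM, show P * (i + 1) = u + h + 1 by omega]
    have : ((n + 1).choose (u + h + 1) : F) = 0 := hsum
    rw [this, zero_mul]
  rw [Nat.cast_mul, add_comm u h] at e₃
  rcases mul_eq_zero.1 e₃ with hz | hz
  · exact hM ((CharP.cast_eq_zero_iff F p M).1 hz)
  · exact hnonzero u (by omega) hz

open Polynomial in
/-- A multiplicative subgroup of order `p ^ e - 1` generating the field is the full unit group. -/
theorem eq_top_of_card_add_one_eq_pow {F : Type*} [Field F] [Fintype F] {p e : ℕ}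
    [Fact p.Prime] [CharP F p] (G : Subgroup Fˣ)
    (hgen : Subfield.closure ((fun u : Fˣ => (u : F)) '' (G : Set Fˣ)) = ⊤)
    (hcard : Nat.card G + 1 = p ^ e) : G = ⊤ := by
  classical
  have hone : 1 < p ^ e := by
    have : 0 < Nat.card G := Nat.card_pos
    omega
  have hfix (x : F) : x ^ p ^ e = x := by
    have hle : Subfield.closure ((fun u : Fˣ => (u : F)) '' (G : Set Fˣ)) ≤
        (iterateFrobenius F p e).eqLocusField (RingHom.id F) := by
      rw [Subfield.closure_le]
      rintro _ ⟨u, hu, rfl⟩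
      change iterateFrobenius F p e (u : F) = (u : F)
      rw [iterateFrobenius_def, ← hcard, pow_succ, G.val_pow_card_eq_one hu, one_mul]
    have hx : x ∈ (iterateFrobenius F p e).eqLocusField (RingHom.id F) :=
      hle (hgen ▸ Subfield.mem_top x)
    have hx' : iterateFrobenius F p e x = x := hx
    rwa [iterateFrobenius_def] at hx'
  have hF : Fintype.card F ≤ p ^ e := by
    by_contra hlt
    have hdeg := FiniteField.X_pow_card_sub_X_natDegree_eq F hone
    refine FiniteField.X_pow_card_sub_X_ne_zero F hone
      (eq_zero_of_natDegree_lt_card_of_eval_eq_zero _ (f := fun x : F => x)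
        Function.injective_id (fun x => by simp [hfix x]) ?_)
    rw [hdeg]
    omega
  refine Subgroup.eq_top_of_le_card G ?_
  rw [Nat.card_eq_fintype_card (α := Fˣ), Fintype.card_units]
  omega

/-- **Theorem (unsigned analogue).** Let `G` be a multiplicative subgroup of a finite field
`F_q` which generates `F_q` as a field, and let `H` be a proper subgroup of `G`. Suppose
that `α + 1 ∈ G` for all `α ∈ G \ H`. Then `G = F_q^*`. -/
theorem near_field_unsigned (F : Type*) [Field F] [Fintype F] (G H : Subgroup Fˣ)
    (hgen : Subfield.closure ((fun u : Fˣ => (u : F)) '' (G : Set Fˣ)) = ⊤)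
    (hHG : H < G)
    (hyp : ∀ α : Fˣ, α ∈ G → α ∉ H → ∃ β ∈ G, (β : F) = (α : F) + 1) :
    G = ⊤ := by
  classical
  obtain ⟨p, hchar⟩ := CharP.exists F
  have hp : p.Prime := CharP.char_is_prime F p
  have : Fact p.Prime := ⟨hp⟩
  have hH : 0 < Nat.card H := Nat.card_pos
  have hlt : Nat.card H < Nat.card G := by
    refine lt_of_le_of_ne (Subgroup.card_le_of_le hHG.le) fun heq => hHG.ne ?_
    exact Subgroup.eq_of_le_of_card_ge hHG.le heq.ge
  obtain ⟨k, hk⟩ := Subgroup.card_dvd_of_le hHG.le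
  have htwo : 2 * Nat.card H ≤ Nat.card G := by
    have : 2 ≤ k := by
      by_contra hk2
      have : k = 0 ∨ k = 1 := by omega
      rcases this with rfl | rfl <;> omega
    rw [hk, mul_comm]
    exact Nat.mul_le_mul_left _ this
  have hpH : ¬ p ∣ Nat.card H := by
    intro hd
    have h₁ : p ∣ Fintype.card F - 1 := by
      rw [← Fintype.card_units, ← Nat.card_eq_fintype_card]
      exact hd.trans (Subgroup.card_subgroup_dvd_card H)
    have h₂ : p ∣ Fintype.card F :=
      (CharP.cast_eq_zero_iff F p _).1 (Nat.cast_card_eq_zero F)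
    have h₃ := (Nat.dvd_sub_iff_right Fintype.card_pos h₂).1 h₁
    exact hp.one_lt.ne' (Nat.dvd_one.1 h₃)
  obtain ⟨e, he⟩ := exists_add_one_eq_pow_of_choose_periodic (F := F) hp hH htwo hpH
    (choose_periodic_of_add_one_mem G H hlt hyp)
  exact eq_top_of_card_add_one_eq_pow G hgen he
end

section
/- Let p be a prime and let k, i be positive integers with k ≡ 0 (mod p) (in fact for any k, i ≥ 0). For any prime power p^s with i < p^s ≤ p^s and any integers k, i with 0 ≤ i ≤ k ≤ p^s - 1, the modular identity (-1)^k * C(k,i) ≡ (-1)^i * C(p^s - 1 - i, p^s - 1 - k) (mod p) holds. -/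
/-- If `p` divides every inner entry of row `q` of Pascal's triangle and `i + m + n + 1 = q`, then
`C(i + m, i) = (-1) ^ m * C(m + n, m)` modulo `p`. -/
theorem cast_choose_eq_neg_one_pow_mul_choose {p q : ℕ}
    (hq : ∀ j, 0 < j → j < q → p ∣ q.choose j) (i m n : ℕ) (h : i + m + n + 1 = q) :
    (((i + m).choose i : ℕ) : ZMod p) = (-1) ^ m * ((m + n).choose m : ℕ) := by
  induction i generalizing m n with
  | zero =>
    induction m generalizing n with
    | zero => simp
    | succ m ih =>
      have hrow := (ZMod.natCast_eq_zero_iff _ _).2 (hq (m + 1) (by omega) (by omega))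
      have hprev := ih (n + 1) (by omega)
      rw [← h, show 0 + (m + 1) + n + 1 = (m + n + 1) + 1 by omega, Nat.choose_succ_succ',
        Nat.cast_add] at hrow
      rw [← add_assoc] at hprev
      rw [show m + 1 + n = m + n + 1 by omega]
      simp only [Nat.choose_zero_right] at hprev ⊢
      linear_combination hprev + (-1) ^ m * hrow
  | succ i ihi =>
    induction m generalizing n with
    | zero => simp
    | succ m ihm =>
      have hleft := ihi (m + 1) (n + 1) (by omega)
      have hprev := ihm (n + 1) (by omega)
      rw [show m + 1 + (n + 1) = (m + n + 1) + 1 by omega, Nat.choose_succ_succ',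
        Nat.cast_add] at hleft
      rw [← add_assoc, show i + 1 + m = i + (m + 1) by omega] at hprev
      rw [show i + 1 + (m + 1) = i + (m + 1) + 1 by omega, Nat.choose_succ_succ',
        show m + 1 + n = m + n + 1 by omega, Nat.cast_add]
      linear_combination hleft + hprev

/-- **Modular identity.** Let `p` be a prime and `p^s` a power of `p`. Then for all integers
`k, i` with `0 ≤ i ≤ k ≤ p^s - 1`, we have
`(-1)^k * C(k,i) ≡ (-1)^i * C(p^s - 1 - i, p^s - 1 - k) (mod p)`. -/
theorem modular_symmetry_identity (p s : ℕ) (hp : p.Prime) :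
    ∀ k i : ℕ, i ≤ k → k ≤ p ^ s - 1 →
      (((-1) ^ k * (k.choose i) : ℤ) ≡
        (-1) ^ i * ((p ^ s - 1 - i).choose (p ^ s - 1 - k)) [ZMOD (p : ℤ)]) := by
  intro k i hik hk
  obtain ⟨m, rfl⟩ := Nat.exists_eq_add_of_le hik
  obtain ⟨n, hn⟩ := Nat.exists_eq_add_of_le hk
  have hpos : 0 < p ^ s := pow_pos hp.pos s
  have key := cast_choose_eq_neg_one_pow_mul_choose (p := p) (q := p ^ s)
    (fun j hj hjq => hp.dvd_choose_pow hj.ne' hjq.ne) i m n (by omega)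
  rw [hn, show i + m + n - i = m + n by omega, show i + m + n - (i + m) = n by omega,
    ← Nat.choose_symm_add, ← ZMod.intCast_eq_intCast_iff]
  push_cast
  have hsign : ((-1 : ZMod p) ^ m) * (-1) ^ m = 1 := by rw [← mul_pow]; simp
  rw [key, pow_add]
  linear_combination (-1) ^ i * ((m + n).choose m : ZMod p) * hsign
end

section
/- Let p be a prime and let k be a positive integer with (-1)^i * C(k,i) ≡ 1 (mod p) for all integers i with 0 ≤ i ≤ k. Then k + 1 is a power of p. -/
/-- If `p` is a prime and `k` a positive integer with `(-1)^i * C(k,i) ≡ 1 (mod p)` for all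
`0 ≤ i ≤ k`, then `k + 1` is a power of `p`. -/
theorem period_one_implies_power (p k : ℕ) (hp : p.Prime) (hk : 0 < k)
    (hcong : ∀ i : ℕ, i ≤ k → (((-1) ^ i * (k.choose i) : ℤ) ≡ 1 [ZMOD (p : ℤ)])) :
    ∃ r : ℕ, k + 1 = p ^ r := by
  have : Fact p.Prime := ⟨hp⟩
  refine ⟨_, Choose.eq_pow_multiplicity_of_choose_modEq_zero (p := p) k.succ_pos
    fun i hi => Int.modEq_zero_iff_dvd.2 ?_⟩
  rw [Finset.mem_Icc] at hi
  obtain ⟨j, rfl⟩ := Nat.exists_eq_add_of_le' hi.1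
  have hdvd := ((hcong j (by lia)).trans (hcong (j + 1) (by lia)).symm).dvd
  have hfactor : ((-1) ^ (j + 1) * (k.choose (j + 1)) - (-1) ^ j * (k.choose j) : ℤ) =
      (-1) ^ (j + 1) * ((k + 1).choose (j + 1) : ℤ) := by
    rw [Nat.choose_succ_succ']
    push_cast
    ring
  rw [hfactor] at hdvd
  exact ((isUnit_one.neg.pow (j + 1)).dvd_mul_left).1 hdvd
end

section
/- Let p be an odd prime, r ≥ 0 an integer, and set k = 2·p^r - 1. Then (-1)^i * C(k,i) ≡ 1 (mod p) for all integers i with 0 ≤ i < p^r, and (-1)^i * C(k,i) ≡ -1 (mod p) for all integers i with p^r ≤ i < 2·p^r. -/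
open Polynomial in
/-- Modulo `p`, the only nonzero interior entry of row `2 * p ^ r` of Pascal's triangle is the
central one, which is `2`. -/
theorem cast_choose_two_mul_prime_pow (p r : ℕ) [Fact p.Prime] {j : ℕ} (hj : 0 < j)
    (hj' : j < 2 * p ^ r) :
    ((2 * p ^ r).choose j : ZMod p) = if j = p ^ r then 2 else 0 := by
  have h : (1 + X : (ZMod p)[X]) ^ (2 * p ^ r) = 1 + C 2 * X ^ p ^ r + X ^ (2 * p ^ r) := by
    rw [mul_comm 2, pow_mul, add_pow_char_pow, one_pow, pow_mul, C_ofNat]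
    ring
  rw [← coeff_one_add_X_pow, h]
  simp [coeff_X_pow, coeff_one, hj.ne', hj'.ne]

/-- Row `2 * p ^ r - 1` of Pascal's triangle with alternating signs, modulo an odd prime `p`. -/
theorem neg_one_pow_mul_cast_choose_two_mul_prime_pow_sub_one (p r : ℕ) [Fact p.Prime]
    (hodd : Odd p) {i : ℕ} (hi : i < 2 * p ^ r) :
    ((-1) ^ i * ((2 * p ^ r - 1).choose i) : ZMod p) = if i < p ^ r then 1 else -1 := by
  have hq : 0 < p ^ r := pow_pos (Fact.out : p.Prime).pos r
  induction i with
  | zero => simp [hq]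
  | succ i ih =>
    have hpascal : (2 * p ^ r).choose (i + 1) =
        (2 * p ^ r - 1).choose i + (2 * p ^ r - 1).choose (i + 1) := by
      rw [← Nat.choose_succ_succ, Nat.succ_eq_add_one, Nat.sub_add_cancel (by lia)]
    have hstep := cast_choose_two_mul_prime_pow p r i.succ_pos hi
    rw [hpascal, Nat.cast_add] at hstep
    have hsum : ((-1) ^ (i + 1) * ((2 * p ^ r - 1).choose (i + 1)) : ZMod p) =
        (-1) ^ i * ((2 * p ^ r - 1).choose i) +
          (-1) ^ (i + 1) * (if i + 1 = p ^ r then 2 else 0) := by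
      rw [← hstep]
      ring
    rw [hsum, ih (by lia)]
    rcases lt_trichotomy (i + 1) (p ^ r) with h | h | h
    · simp [h, h.ne, (Nat.lt_succ_self i).trans h]
    · have hsign : (-1 : ZMod p) ^ (i + 1) = -1 := by
        rw [h]
        exact (hodd.pow (n := r)).neg_one_pow
      rw [hsign, if_pos (by lia), if_pos h, if_neg (by lia)]
      ring
    · rw [if_neg (by lia), if_neg h.ne', if_neg (by lia)]
      ring

/-- Let `p` be an odd prime, `r ≥ 0` an integer, and `k = 2·p^r - 1`. Then
`(-1)^i * C(k,i) ≡ 1 (mod p)` for `0 ≤ i < p^r`, and `(-1)^i * C(k,i) ≡ -1 (mod p)` for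
`p^r ≤ i < 2·p^r`. -/
theorem signed_binomials_two_blocks (p r : ℕ) (hp : p.Prime) (hodd : Odd p) :
    (∀ i : ℕ, i < p ^ r →
      (((-1) ^ i * ((2 * p ^ r - 1).choose i) : ℤ) ≡ 1 [ZMOD (p : ℤ)])) ∧
    (∀ i : ℕ, p ^ r ≤ i → i < 2 * p ^ r →
      (((-1) ^ i * ((2 * p ^ r - 1).choose i) : ℤ) ≡ -1 [ZMOD (p : ℤ)])) := by
  have : Fact p.Prime := ⟨hp⟩
  refine ⟨fun i hi => ?_, fun i hi hi' => ?_⟩ <;> rw [← ZMod.intCast_eq_intCast_iff] <;> push_cast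
  · rw [neg_one_pow_mul_cast_choose_two_mul_prime_pow_sub_one p r hodd (by lia), if_pos hi]
  · rw [neg_one_pow_mul_cast_choose_two_mul_prime_pow_sub_one p r hodd hi', if_neg hi.not_gt]
end

section
/- Let r ≥ 0 be an integer and set k = 4·3^r - 1. Then (-1)^i * C(k,i) ≡ 1 (mod 3) for all integers i with 0 ≤ i < 3^r, (-1)^i * C(k,i) ≡ 0 (mod 3) for all integers i with 3^r ≤ i < 3·3^r, and (-1)^i * C(k,i) ≡ -1 (mod 3) for all integers i with 3·3^r ≤ i < 4·3^r. -/
/-- Modulo `3`, the signed binomials of row `3 * k + 2` repeat each signed binomial of row `k`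
three times. -/
theorem neg_one_pow_mul_choose_three_mul_add_two_modEq (k i : ℕ) :
    ((-1) ^ i * ((3 * k + 2).choose i) : ℤ) ≡
      (-1) ^ (i / 3) * (k.choose (i / 3)) [ZMOD (3 : ℤ)] := by
  have : Fact (Nat.Prime 3) := ⟨Nat.prime_three⟩
  have lucas := Choose.choose_modEq_choose_mod_mul_choose_div (n := 3 * k + 2) (k := i) (p := 3)
  have hmod : (3 * k + 2) % 3 = 2 := by omega
  have hdiv : (3 * k + 2) / 3 = k := by omega
  rw [hmod, hdiv] at lucas
  have sign : (-1 : ℤ) ^ i = (-1) ^ (i % 3) * (-1) ^ (i / 3) := by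
    conv_lhs => rw [← Nat.mod_add_div i 3, pow_add, pow_mul]
    norm_num
  have digit : ((-1) ^ (i % 3) * (Nat.choose 2 (i % 3)) : ℤ) ≡ 1 [ZMOD (3 : ℤ)] := by
    have : i % 3 < 3 := Nat.mod_lt _ (by norm_num)
    interval_cases i % 3 <;> decide
  calc ((-1) ^ i * ((3 * k + 2).choose i) : ℤ)
      ≡ (-1) ^ i * (Nat.choose 2 (i % 3) * k.choose (i / 3)) [ZMOD (3 : ℤ)] := by
        exact_mod_cast lucas.mul_left _
    _ = ((-1) ^ (i % 3) * Nat.choose 2 (i % 3)) * ((-1) ^ (i / 3) * k.choose (i / 3)) := by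
        rw [sign]; ring
    _ ≡ 1 * ((-1) ^ (i / 3) * k.choose (i / 3)) [ZMOD (3 : ℤ)] := digit.mul_right _
    _ = (-1) ^ (i / 3) * k.choose (i / 3) := one_mul _

/-- Let `r ≥ 0` be an integer and `k = 4·3^r - 1`. Then, modulo `3`,
`(-1)^i * C(k,i) ≡ 1` for `0 ≤ i < 3^r`, `(-1)^i * C(k,i) ≡ 0` for `3^r ≤ i < 3·3^r`,
and `(-1)^i * C(k,i) ≡ -1` for `3·3^r ≤ i < 4·3^r`. -/
theorem signed_binomials_three_blocks (r : ℕ) :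
    (∀ i : ℕ, i < 3 ^ r →
      (((-1) ^ i * ((4 * 3 ^ r - 1).choose i) : ℤ) ≡ 1 [ZMOD (3 : ℤ)])) ∧
    (∀ i : ℕ, 3 ^ r ≤ i → i < 3 * 3 ^ r →
      (((-1) ^ i * ((4 * 3 ^ r - 1).choose i) : ℤ) ≡ 0 [ZMOD (3 : ℤ)])) ∧
    (∀ i : ℕ, 3 * 3 ^ r ≤ i → i < 4 * 3 ^ r →
      (((-1) ^ i * ((4 * 3 ^ r - 1).choose i) : ℤ) ≡ -1 [ZMOD (3 : ℤ)])) := by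
  induction r with
  | zero =>
    refine ⟨fun i h => ?_, fun i h h' => ?_, fun i h h' => ?_⟩ <;>
      norm_num at h <;> try norm_num at h'
    · subst h; decide
    · interval_cases i <;> decide
    · interval_cases i; decide
  | succ r ih =>
    obtain ⟨first, middle, last⟩ := ih
    have row : 4 * 3 ^ (r + 1) - 1 = 3 * (4 * 3 ^ r - 1) + 2 := by
      have : 0 < 3 ^ r := by positivity
      omega
    rw [row]
    refine ⟨fun i h => ?_, fun i h h' => ?_, fun i h h' => ?_⟩ <;>
      refine (neg_one_pow_mul_choose_three_mul_add_two_modEq _ i).trans ?_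
    · exact first _ (by omega)
    · exact middle _ (by omega) (by omega)
    · exact last _ (by omega) (by omega)
end

section
/- Let p be a prime and let s ≤ t be nonnegative integers. If k is an integer with p^t - p^s ≤ k < p^t, then the signed binomial coefficient (-1)^i * C(k,i) viewed modulo p is a periodic function of i with period p^s in the range 0 ≤ i ≤ k, i.e. C(k, i + p^s) ≡ (-1)^{p^s} * C(k,i) (mod p) for all integers i with 0 ≤ i ≤ k - p^s. -/
open Polynomial in
/-- Comparing coefficients in `(1 + X)^k * (1 + X^(p^s)) = (1 + X)^r * (1 + X^(p^t))`, where
`k + p^s = r + p^t` and `r < p^s`. -/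
theorem choose_add_prime_pow_add_choose_eq_zero {R : Type*} [CommSemiring R] (p : ℕ)
    [ExpChar R p] {s t k r : ℕ} (h : k + p ^ s = r + p ^ t) (hr : r < p ^ s) {i : ℕ}
    (hi : i + p ^ s < p ^ t) :
    (k.choose (i + p ^ s) : R) + (k.choose i : R) = 0 := by
  have key : ((1 + X) ^ k * (1 + X ^ p ^ s) : R[X]) = (1 + X) ^ r * (1 + X ^ p ^ t) := by
    have frob (n : ℕ) : (1 + X ^ p ^ n : R[X]) = (1 + X) ^ p ^ n := by
      rw [add_pow_expChar_pow, one_pow]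
    rw [frob, frob, ← pow_add, ← pow_add, h]
  have hcoeff := congrArg (fun f : R[X] => f.coeff (i + p ^ s)) key
  simpa only [mul_add, mul_one, coeff_add, coeff_mul_X_pow', if_neg hi.not_ge, Nat.le_add_left,
    if_true, Nat.add_sub_cancel,
    coeff_one_add_X_pow, Nat.choose_eq_zero_of_lt (hr.trans_le (Nat.le_add_left _ i)),
    Nat.cast_zero, add_zero] using hcoeff

/-- Let `p` be a prime and `s ≤ t` nonnegative integers. If `k` is an integer with
`p^t - p^s ≤ k < p^t`, then `(-1)^i * C(k,i) (mod p)` is a periodic function of `i` with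
period `p^s` in the range `0 ≤ i ≤ k`, i.e.
`C(k, i + p^s) ≡ (-1)^(p^s) * C(k,i) (mod p)` for all `0 ≤ i ≤ k - p^s`. -/
theorem signed_binomials_p_power_period (p s t k : ℕ) (hp : p.Prime) (hst : s ≤ t)
    (hk1 : p ^ t - p ^ s ≤ k) (hk2 : k < p ^ t) :
    ∀ i : ℕ, i + p ^ s ≤ k →
      ((k.choose (i + p ^ s) : ℤ) ≡ (-1) ^ (p ^ s) * (k.choose i) [ZMOD (p : ℤ)]) := by
  intro i hi
  have : Fact p.Prime := ⟨hp⟩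
  have hadd : (k.choose (i + p ^ s) : ZMod p) + (k.choose i : ZMod p) = 0 :=
    choose_add_prime_pow_add_choose_eq_zero p (t := t) (r := k + p ^ s - p ^ t)
      (by omega) (by omega) (by omega)
  rw [← ZMod.intCast_eq_intCast_iff]
  push_cast
  rw [neg_one_pow_expChar_pow, neg_one_mul]
  exact eq_neg_of_add_eq_zero_left hadd
end
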